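/- arXiv:2206.09634 — 9 statements merged into one kernel-verified Lean document; each statement's English description precedes it below -/
import Mathlib

section
/- Let A ⊆ B be a regular masa inclusion of C*-algebras. Then the inclusion A ⊆ B is aperiodic: for every b ∈ B, every ε > 0 and every nonzero hereditary C*-subalgebra D ⊆ A, there exists a positive element a ∈ D with ‖a‖ = 1 such that dist(a b a, A) < ε, where dist denotes distance in the norm of B. -/
/-- A normaliser of `A` in `B`: an element `n` with `n* a n ∈ A` and `n a n* ∈ A`
for all `a ∈ A`. -/
def IsNormalizer {B : Type*} [NonUnitalCStarAlgebra B]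
    (A : NonUnitalStarSubalgebra ℂ B) (n : B) : Prop :=
  (∀ a ∈ A, star n * a * n ∈ A) ∧ (∀ a ∈ A, n * a * star n ∈ A)

lemma exists_character_apply_ne_zero {C : Type*} [NonUnitalCommCStarAlgebra C] {x : C}
    (hx : x ≠ 0) : ∃ χ : C →⋆ₙₐ[ℂ] ℂ, χ x ≠ 0 := by
  have hx' : (x : Unitization ℂ C) ≠ 0 := fun h =>
    hx (Unitization.inr_injective (R := ℂ) (by simpa using h))
  have h : WeakDual.gelfandTransform ℂ (Unitization ℂ C) x ≠ 0 := by
    rw [← map_zero (WeakDual.gelfandTransform ℂ (Unitization ℂ C))]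
    exact (gelfandTransform_isometry (Unitization ℂ C)).injective.ne hx'
  obtain ⟨φ, hφ⟩ := DFunLike.ne_iff.mp h
  let ψ : Unitization ℂ C →⋆ₐ[ℂ] ℂ :=
    { WeakDual.CharacterSpace.toAlgHom φ with map_star' := map_star φ }
  exact ⟨(ψ : Unitization ℂ C →⋆ₙₐ[ℂ] ℂ).comp (Unitization.inrNonUnitalStarAlgHom ℂ C), hφ⟩

lemma NonUnitalStarSubalgebra.exists_character_apply_ne_zero {B : Type*}
    [NonUnitalCStarAlgebra B] {A : NonUnitalStarSubalgebra ℂ B} (hclosed : IsClosed (A : Set B))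
    (hcomm : ∀ a ∈ A, ∀ a' ∈ A, a * a' = a' * a) {x : A} (hx : x ≠ 0) :
    ∃ χ : A →⋆ₙₐ[ℂ] ℂ, χ x ≠ 0 := by
  have : IsClosed (A : Set B) := hclosed
  let _ : NonUnitalCommCStarAlgebra A :=
    { NonUnitalStarSubalgebra.nonUnitalCStarAlgebra A with
      mul_comm := fun a b => Subtype.ext (hcomm a a.2 b b.2) }
  exact _root_.exists_character_apply_ne_zero hx

lemma character_apply_of_isSelfAdjoint {B : Type*} [NonUnitalCStarAlgebra B]
    {A : NonUnitalStarSubalgebra ℂ B} (χ : A →⋆ₙₐ[ℂ] ℂ) {x : A} (hx : IsSelfAdjoint x) :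
    ∃ r : ℝ, χ x = r := by
  have : IsSelfAdjoint (χ x) := hx.map χ
  exact ⟨(χ x).re, (Complex.conj_eq_iff_re.mp this.star_eq).symm⟩

lemma eq_mul_of_forall_le {M K β : ℝ} (h₁ : ∀ r > β, M ≤ r * K) (h₂ : ∀ r < β, r * K ≤ M) :
    M = β * K := by
  have hc : Continuous fun r : ℝ => r * K := by fun_prop
  refine le_antisymm ?_ ?_
  · exact ge_of_tendsto (hc.continuousWithinAt (s := Set.Ioi β) (x := β))
      (Filter.eventually_of_mem self_mem_nhdsWithin h₁)
  · exact le_of_tendsto (hc.continuousWithinAt (s := Set.Iio β) (x := β))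
      (Filter.eventually_of_mem self_mem_nhdsWithin h₂)

/-- The map `a ↦ n a n*` on `A` induced by a normaliser `n`. -/
def IsNormalizer.conj {B : Type*} [NonUnitalCStarAlgebra B]
    {A : NonUnitalStarSubalgebra ℂ B} {n : B} (hn : IsNormalizer A n) : A →ₗ[ℂ] A where
  toFun x := ⟨n * x * star n, hn.2 x x.2⟩
  map_add' x y := Subtype.ext (by simp [mul_add, add_mul])
  map_smul' c x := Subtype.ext (by simp [mul_smul_comm, smul_mul_assoc])

lemma IsSelfAdjoint.mul_self_ne_zero {B : Type*} [NonUnitalCStarAlgebra B]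
    {A : NonUnitalStarSubalgebra ℂ B} {h : A} (hh : IsSelfAdjoint h) (hne : h ≠ 0) :
    h * h ≠ 0 := by
  refine fun h0 => hne (Subtype.ext ((CStarRing.star_mul_self_eq_zero_iff (h : B)).mp ?_))
  rw [show star (h : B) = h from congrArg Subtype.val hh]
  exact congrArg Subtype.val h0

/-- `A` compresses `x` into itself: every nonzero self-adjoint `h ∈ A` has a nonzero
self-adjoint multiple `k ∈ h A` such that the compressions of `x` by `kz`, `z ∈ A`, lie in `A`. -/
def CompressesInto {B : Type*} [NonUnitalCStarAlgebra B]
    (A : NonUnitalStarSubalgebra ℂ B) (x : B) : Prop :=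
  ∀ h : A, IsSelfAdjoint h → h ≠ 0 → ∃ w : A, IsSelfAdjoint (h * w) ∧ h * w ≠ 0 ∧
    ∀ z : A, ((h * w * z : A) : B) * x * ((h * w * z : A) : B) ∈ A

lemma CompressesInto.add {B : Type*} [NonUnitalCStarAlgebra B]
    {A : NonUnitalStarSubalgebra ℂ B} {x y : B}
    (hx : CompressesInto A x) (hy : CompressesInto A y) : CompressesInto A (x + y) := by
  intro h hh hne
  obtain ⟨w, hw, hw0, hwx⟩ := hx h hh hne
  obtain ⟨w', hw', hw0', hwy⟩ := hy (h * w) hw hw0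
  refine ⟨w * w', by rwa [← mul_assoc], by rwa [← mul_assoc], fun z => ?_⟩
  rw [mul_add, add_mul]
  refine add_mem ?_ ?_
  · simpa [mul_assoc] using hwx (w' * z)
  · simpa [mul_assoc] using hwy z

lemma CompressesInto.smul {B : Type*} [NonUnitalCStarAlgebra B]
    {A : NonUnitalStarSubalgebra ℂ B} {x : B} (hx : CompressesInto A x) (c : ℂ) :
    CompressesInto A (c • x) := by
  intro h hh hne
  obtain ⟨w, hw, hw0, hwx⟩ := hx h hh hne
  refine ⟨w, hw, hw0, fun z => ?_⟩
  rw [mul_smul_comm, smul_mul_assoc]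
  exact SMulMemClass.smul_mem c (hwx z)

lemma CompressesInto.zero {B : Type*} [NonUnitalCStarAlgebra B]
    {A : NonUnitalStarSubalgebra ℂ B} : CompressesInto A (0 : B) := by
  intro h hh hne
  refine ⟨h, by simpa [hh.star_eq] using IsSelfAdjoint.star_mul_self h,
    hh.mul_self_ne_zero hne, ?_⟩
  simp

section

variable {B : Type*} [NonUnitalCStarAlgebra B] [PartialOrder B] [StarOrderedRing B]
  {A : NonUnitalStarSubalgebra ℂ B}

lemma exists_isSelfAdjoint_mul_self_eq (hclosed : IsClosed (A : Set B)) {c : B} (hc : c ∈ A)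
    (hc0 : 0 ≤ c) : ∃ q ∈ A, IsSelfAdjoint q ∧ q * q = c := by
  refine ⟨CFC.sqrt c, ?_, (CFC.sqrt_nonneg c).isSelfAdjoint, CFC.sqrt_mul_sqrt_self c⟩
  rw [CFC.sqrt_eq_real_sqrt c]
  exact cfcₙ_mem (hs := hclosed) _ hc

lemma exists_sub_of_isSelfAdjoint (hclosed : IsClosed (A : Set B)) {y : B} (hy : y ∈ A)
    (hsa : IsSelfAdjoint y) :
    ∃ u ∈ A, ∃ v ∈ A, 0 ≤ u ∧ 0 ≤ v ∧ u * v = 0 ∧ u - v = y :=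
  ⟨y⁺, cfcₙ_mem (hs := hclosed) _ hy, y⁻, cfcₙ_mem (hs := hclosed) _ hy, CFC.posPart_nonneg y,
    CFC.negPart_nonneg y, CFC.posPart_mul_negPart y, CFC.posPart_sub_negPart y⟩

lemma character_apply_of_nonneg (hclosed : IsClosed (A : Set B)) (χ : A →⋆ₙₐ[ℂ] ℂ) (x : A)
    (hx : (0 : B) ≤ x) : ∃ r : ℝ, 0 ≤ r ∧ χ x = r := by
  obtain ⟨q, hq, hqs, hqx⟩ := exists_isSelfAdjoint_mul_self_eq hclosed x.2 hx
  have h : x = star ⟨q, hq⟩ * ⟨q, hq⟩ := Subtype.ext (by simp [hqs.star_eq, hqx])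
  refine ⟨Complex.normSq (χ ⟨q, hq⟩), Complex.normSq_nonneg _, ?_⟩
  rw [h, map_mul, map_star, Complex.normSq_eq_conj_mul_self]
  rfl

lemma IsNormalizer.conj_nonneg {n : B} (hn : IsNormalizer A n) {x : A} (hx : (0 : B) ≤ x) :
    (0 : B) ≤ hn.conj x := star_right_conjugate_nonneg hx n

lemma IsNormalizer.character_conj (hclosed : IsClosed (A : Set B)) {n : B}
    (hn : IsNormalizer A n) {h : A} (hh : IsSelfAdjoint h)
    (H : ∀ u v : A, (0 : B) ≤ u → (0 : B) ≤ v → u * v = 0 →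
      ((h * v * h : A) : B) * n * ((h * u * h : A) : B) = 0)
    (χ : A →⋆ₙₐ[ℂ] ℂ) (hχ : χ h ≠ 0) {b : A} (hb : IsSelfAdjoint b) :
    χ (hn.conj (h * h * b * (h * h))) = χ b * χ (hn.conj (h * h * (h * h))) := by
  obtain ⟨η, hη⟩ := character_apply_of_isSelfAdjoint χ hh
  obtain ⟨β, hβ⟩ := character_apply_of_isSelfAdjoint χ hb
  have hη0 : 0 < η ^ 4 := by
    have : η ≠ 0 := by rintro rfl; simp [hη] at hχ
    positivity
  have hsa : ∀ x : A, IsSelfAdjoint x → IsSelfAdjoint (hn.conj x) := fun x hx =>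
    Subtype.ext (IsSelfAdjoint.conjugate (x := (x : B)) (congrArg Subtype.val hx) n)
  have hhh : IsSelfAdjoint (h * h) := by simpa [hh.star_eq] using IsSelfAdjoint.star_mul_self h
  obtain ⟨M, hM⟩ := character_apply_of_isSelfAdjoint χ
    (hsa (h * h * b * (h * h)) (by simpa [hhh.star_eq] using hb.conjugate (h * h)))
  obtain ⟨K, hK⟩ := character_apply_of_isSelfAdjoint χ
    (hsa (h * h * (h * h)) (by simpa [hhh.star_eq] using IsSelfAdjoint.star_mul_self (h * h)))
  have key : ∀ r : ℝ, ∃ p q P Q : ℝ, 0 ≤ p ∧ 0 ≤ q ∧ 0 ≤ P ∧ 0 ≤ Q ∧ q * P = 0 ∧ p * Q = 0 ∧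
      p - q = η ^ 4 * (β - r) ∧ P - Q = M - r * K := by
    intro r
    have hy : IsSelfAdjoint (h * b * h - (r : ℂ) • (h * h)) := by
      refine .sub (by simpa [hh.star_eq] using hb.conjugate h) (.smul ?_ hhh)
      simp [IsSelfAdjoint]
    obtain ⟨u, hu, v, hv, hu0, hv0, huv, hsub⟩ :=
      exists_sub_of_isSelfAdjoint hclosed (Subtype.mem _) (congrArg Subtype.val hy :)
    lift u to A using hu
    lift v to A using hv
    have huv : u * v = 0 := Subtype.ext huv
    have hvu : v * u = 0 := by
      have := congrArg star huv
      rwa [star_mul, star_zero, show star u = u from Subtype.ext hu0.isSelfAdjoint,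
        show star v = v from Subtype.ext hv0.isSelfAdjoint] at this
    have hsub : u - v = h * b * h - (r : ℂ) • (h * h) := Subtype.ext hsub
    have hsub' : h * u * h - h * v * h = h * h * b * (h * h) - (r : ℂ) • (h * h * (h * h)) := by
      rw [← sub_mul, ← mul_sub, hsub]
      simp only [mul_sub, sub_mul, mul_assoc, mul_smul_comm, smul_mul_assoc]
    have hpos : ∀ w : A, (0 : B) ≤ w → (0 : B) ≤ (h * w * h : A) := fun w hw => by
      have := star_left_conjugate_nonneg hw (h : B)
      rwa [show star (h : B) = h from congrArg Subtype.val hh] at this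
    have hzero : ∀ u v : A, (0 : B) ≤ u → (0 : B) ≤ v → u * v = 0 →
        χ (h * v * h) * χ (hn.conj (h * u * h)) = 0 := fun u v hu hv huv => by
      rw [← map_mul, ← map_zero χ]
      congr 1
      apply Subtype.ext
      change ((h * v * h : A) : B) * (n * ((h * u * h : A) : B) * star n) = 0
      rw [← mul_assoc, ← mul_assoc, H u v hu hv huv, zero_mul]
    have h₁ := hzero u v hu0 hv0 huv
    have h₂ := hzero v u hv0 hu0 hvu
    obtain ⟨p, hp0, hp⟩ := character_apply_of_nonneg hclosed χ _ (hpos u hu0)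
    obtain ⟨q, hq0, hq⟩ := character_apply_of_nonneg hclosed χ _ (hpos v hv0)
    obtain ⟨P, hP0, hP⟩ := character_apply_of_nonneg hclosed χ _ (hn.conj_nonneg (hpos u hu0))
    obtain ⟨Q, hQ0, hQ⟩ := character_apply_of_nonneg hclosed χ _ (hn.conj_nonneg (hpos v hv0))
    have h₃ := congrArg χ hsub'
    have h₄ := congrArg (fun x => χ (hn.conj x)) hsub'
    simp only [map_sub, map_smul, hp, hq] at h₃
    simp only [map_sub, map_smul, hP, hQ, hM, hK, smul_eq_mul] at h₄
    simp only [map_mul, hη, hβ] at h₃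
    rw [hq, hP] at h₁
    rw [hp, hQ] at h₂
    refine ⟨p, q, P, Q, hp0, hq0, hP0, hQ0, mod_cast h₁, mod_cast h₂, ?_, mod_cast h₄⟩
    have : ((p - q : ℝ) : ℂ) = ((η ^ 4 * (β - r) : ℝ) : ℂ) := by
      push_cast
      rw [h₃, smul_eq_mul]
      ring
    exact_mod_cast this
  have hMK : M = β * K := by
    refine eq_mul_of_forall_le (fun r hr => ?_) (fun r hr => ?_) <;>
      obtain ⟨p, q, P, Q, hp, hq, hP, hQ, hqP, hpQ, hpq, hPQ⟩ := key r
    · have : 0 < q := by nlinarith [mul_pos hη0 (sub_pos.mpr hr)]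
      have : P = 0 := by simpa [this.ne'] using hqP
      linarith
    · have : 0 < p := by nlinarith [mul_pos hη0 (sub_pos.mpr hr)]
      have : Q = 0 := by simpa [this.ne'] using hpQ
      linarith
  rw [hM, hK, hβ, hMK]
  push_cast
  rfl

lemma IsNormalizer.commute_of_isSelfAdjoint (hclosed : IsClosed (A : Set B))
    (hcomm : ∀ a ∈ A, ∀ a' ∈ A, a * a' = a' * a) {n : B}
    (hn : IsNormalizer A n) {h : A} (hh : IsSelfAdjoint h)
    (H : ∀ u v : A, (0 : B) ≤ u → (0 : B) ≤ v → u * v = 0 →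
      ((h * v * h : A) : B) * n * ((h * u * h : A) : B) = 0)
    {b : A} (hb : IsSelfAdjoint b) :
    Commute (((h * h : A) : B) * n * ((h * h : A) : B)) (b : B) := by
  set k := h * h with hk
  have hks : IsSelfAdjoint k := by simpa [hh.star_eq] using IsSelfAdjoint.star_mul_self h
  have hkB : star (k : B) = k := congrArg Subtype.val hks
  have hbB : star (b : B) = b := congrArg Subtype.val hb
  set Y : B := k * n * k * b - b * (k * n * k) with hY
  let W : A := k * hn.conj (k * (b * b) * k) * k - k * hn.conj (k * b * k) * k * b
    - b * k * hn.conj (k * b * k) * k + b * k * hn.conj (k * k) * k * b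
  have hW : (W : B) = Y * star Y := by
    change (k : B) * (n * (k * (b * b) * k : B) * star n) * k
      - k * (n * (k * b * k : B) * star n) * k * b
      - b * k * (n * (k * b * k : B) * star n) * k + b * k * (n * (k * k : B) * star n) * k * b = _
    simp only [hY, star_sub, star_mul, hkB, hbB, mul_sub, sub_mul, mul_assoc]
    abel
  have hW0 : W = 0 := by
    by_contra hne
    obtain ⟨χ, hχ⟩ := NonUnitalStarSubalgebra.exists_character_apply_ne_zero hclosed hcomm hne
    apply hχ
    simp only [W, map_add, map_sub, map_mul]
    by_cases hχh : χ h = 0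
    · simp [hk, hχh]
    · have h₁ := hn.character_conj hclosed hh H χ hχh hb
      have h₂ := hn.character_conj hclosed hh H χ hχh
        (b := b * b) (by simpa [hb.star_eq] using IsSelfAdjoint.star_mul_self b)
      rw [← hk] at h₁ h₂
      rw [h₁, h₂, map_mul χ b b]
      ring
  have hY0 : Y = 0 := by
    rw [← CStarRing.mul_star_self_eq_zero_iff, ← hW, hW0]
    rfl
  exact sub_eq_zero.mp hY0

lemma IsNormalizer.conjugate_mem (hclosed : IsClosed (A : Set B))
    (hcomm : ∀ a ∈ A, ∀ a' ∈ A, a * a' = a' * a)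
    (hmasa : ∀ b : B, (∀ a ∈ A, b * a = a * b) → b ∈ A) {n : B}
    (hn : IsNormalizer A n) {h : A} (hh : IsSelfAdjoint h)
    (H : ∀ u v : A, (0 : B) ≤ u → (0 : B) ≤ v → u * v = 0 →
      ((h * v * h : A) : B) * n * ((h * u * h : A) : B) = 0) :
    ((h * h : A) : B) * n * ((h * h : A) : B) ∈ A := by
  refine hmasa _ fun a ha => ?_
  have key := fun b : A => hn.commute_of_isSelfAdjoint hclosed hcomm hh H (b := b)
  have hdec := realPart_add_I_smul_imaginaryPart (⟨a, ha⟩ : A)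
  have hdec' : a = ((realPart (⟨a, ha⟩ : A) : A) : B)
      + Complex.I • ((imaginaryPart (⟨a, ha⟩ : A) : A) : B) := (congrArg Subtype.val hdec).symm
  rw [hdec']
  exact (key _ (realPart _).2).add_right ((key _ (imaginaryPart _).2).smul_right _)

lemma IsNormalizer.compressesInto (hclosed : IsClosed (A : Set B))
    (hcomm : ∀ a ∈ A, ∀ a' ∈ A, a * a' = a' * a)
    (hmasa : ∀ b : B, (∀ a ∈ A, b * a = a * b) → b ∈ A) {n : B}
    (hn : IsNormalizer A n) : CompressesInto A n := by
  intro h hh hne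
  have hc : ∀ x y : A, x * y = y * x := fun x y => Subtype.ext (hcomm x x.2 y y.2)
  by_cases H : ∀ u v : A, (0 : B) ≤ u → (0 : B) ≤ v → u * v = 0 →
      ((h * v * h : A) : B) * n * ((h * u * h : A) : B) = 0
  · refine ⟨h, by simpa [hh.star_eq] using IsSelfAdjoint.star_mul_self h,
      hh.mul_self_ne_zero hne, fun z => ?_⟩
    have := mul_mem (mul_mem z.2 (hn.conjugate_mem hclosed hcomm hmasa hh H)) z.2
    rw [show ((h * h * z : A) : B) * n * ((h * h * z : A) : B)
      = ((z * (h * h) : A) : B) * n * ((h * h * z : A) : B) by rw [hc z]]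
    simpa [mul_assoc] using this
  · push Not at H
    obtain ⟨u, v, hu, hv, huv, hne'⟩ := H
    have hpos : ∀ w : A, (0 : B) ≤ w → IsSelfAdjoint (h * w * h) := fun w hw => by
      have : IsSelfAdjoint w := Subtype.ext hw.isSelfAdjoint
      simpa [hh.star_eq] using this.conjugate h
    have hf := hpos u hu
    have hg := hpos v hv
    set f := h * u * h with hfdef
    set g := h * v * h with hgdef
    have hfg : f * g = 0 := by
      rw [hfdef, hgdef, show h * u * h = h * h * u by rw [mul_assoc, hc u h, ← mul_assoc],
        show h * v * h = v * (h * h) by rw [hc h v, mul_assoc], mul_assoc, ← mul_assoc u v, huv,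
        zero_mul, mul_zero]
    have hfB : star (f : B) = f := congrArg Subtype.val hf
    have hgB : star (g : B) = g := congrArg Subtype.val hg
    let E : A := ⟨star n * (g * g : A) * n, hn.1 _ (g * g).2⟩
    have hp : ((f * E * f : A) : B) = star (g * n * f : B) * (g * n * f) := by
      change (f : B) * (star n * (g * g) * n) * f = _
      simp [hfB, hgB, mul_assoc]
    have hk : h * (u * h * E * f) = f * E * f := by simp only [hfdef, mul_assoc]
    have hz : ((f * E * f : A) : B) * n * ((f * E * f : A) : B) = 0 := by
      have h₀ : (f : B) * (n * f * star n) * g = 0 := by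
        have : f * hn.conj f * g = 0 := by
          rw [mul_assoc, hc (hn.conj f), ← mul_assoc, hfg, zero_mul]
        exact congrArg Subtype.val this
      calc _ = star (g * n * f : B) * (g * n * (f * (n * f * star n) * g)) * (g * n * f) := by
            rw [hp]; simp only [star_mul, hfB, hgB, mul_assoc]
        _ = 0 := by rw [h₀]; simp
    refine ⟨u * h * E * f, ?_, ?_, fun z => ?_⟩
    · rw [hk]
      exact Subtype.ext (by
        change star ((f * E * f : A) : B) = _
        rw [hp]; simp [mul_assoc])
    · rw [hk]
      intro h0
      exact hne' ((CStarRing.star_mul_self_eq_zero_iff _).mp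
        (hp.symm.trans (congrArg Subtype.val h0)))
    · rw [hk]
      have : ((f * E * f * z : A) : B) * n * ((f * E * f * z : A) : B)
          = z * (((f * E * f : A) : B) * n * ((f * E * f : A) : B)) * z := by
        nth_rewrite 1 [hc (f * E * f) z]
        change (z : B) * ((f * E * f : A) : B) * n * (((f * E * f : A) : B) * z) = _
        simp only [mul_assoc]
      rw [this, hz]
      simp

lemma compressesInto_of_mem_span (hclosed : IsClosed (A : Set B))
    (hcomm : ∀ a ∈ A, ∀ a' ∈ A, a * a' = a' * a)
    (hmasa : ∀ b : B, (∀ a ∈ A, b * a = a * b) → b ∈ A) {x : B}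
    (hx : x ∈ Submodule.span ℂ {n : B | IsNormalizer A n}) : CompressesInto A x := by
  induction hx using Submodule.span_induction with
  | mem n hn => exact IsNormalizer.compressesInto hclosed hcomm hmasa hn
  | zero => exact .zero
  | add x y _ _ hx hy => exact hx.add hy
  | smul c x _ hx => exact hx.smul c

end

/-- A regular masa inclusion `A ⊆ B` of C*-algebras is aperiodic:
for every `b ∈ B`, every `ε > 0` and every nonzero hereditary C*-subalgebra `D ⊆ A`,
there is a positive `a ∈ D` with `‖a‖ = 1` and `dist (a * b * a) A < ε`. -/
theorem stmt0 {B : Type*} [NonUnitalCStarAlgebra B] [PartialOrder B] [StarOrderedRing B]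
    (A : NonUnitalStarSubalgebra ℂ B) (hAclosed : IsClosed (A : Set B))
    -- `A` is commutative
    (hAcomm : ∀ a ∈ A, ∀ a' ∈ A, a * a' = a' * a)
    -- `A` is maximal abelian in `B`
    (hAmasa : ∀ b : B, (∀ a ∈ A, b * a = a * b) → b ∈ A)
    -- the inclusion is regular
    (hreg : closure (Submodule.span ℂ {n : B | IsNormalizer A n} : Set B) = Set.univ) :
    ∀ b : B, ∀ ε > (0 : ℝ),
      ∀ D : NonUnitalStarSubalgebra ℂ B, IsClosed (D : Set B) → (D : Set B) ⊆ A →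
        -- hereditary: `a ∈ D` whenever `a ∈ A`, `d ∈ D` and `0 ≤ a ≤ d`
        (∀ a ∈ A, ∀ d ∈ D, 0 ≤ a → a ≤ d → a ∈ D) →
        -- `D` is nonzero
        (∃ d ∈ D, d ≠ 0) →
        ∃ a ∈ D, 0 ≤ a ∧ ‖a‖ = 1 ∧ Metric.infDist (a * b * a) (A : Set B) < ε := by
  intro b ε hε D hDclosed hDA hDher ⟨d, hd, hd0⟩
  have hb : b ∈ closure (Submodule.span ℂ {n : B | IsNormalizer A n} : Set B) := by simp [hreg]
  obtain ⟨x, hx, hbx⟩ := Metric.mem_closure_iff.mp hb ε hε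
  let h : A := ⟨star d * d, hDA (mul_mem (star_mem hd) hd)⟩
  have hD : (h : B) ∈ D := mul_mem (star_mem hd) hd
  have hh : IsSelfAdjoint h := Subtype.ext (IsSelfAdjoint.star_mul_self d).star_eq
  have hne : h ≠ 0 := fun h0 =>
    hd0 ((CStarRing.star_mul_self_eq_zero_iff d).mp (congrArg Subtype.val h0))
  obtain ⟨w, hw, hw0, hwx⟩ := compressesInto_of_mem_span hAclosed hAcomm hAmasa hx h hh hne
  have hwB : star ((h * w : A) : B) = (h * w : A) := congrArg Subtype.val hw
  set a₀ : B := ((h * w : A) : B) * ((h * w : A) : B) with ha₀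
  have ha₀_nonneg : 0 ≤ a₀ := by
    simpa only [hwB] using star_mul_self_nonneg ((h * w : A) : B)
  have ha₀_ne : a₀ ≠ 0 := fun h0 => hw0 <| Subtype.ext <|
    (CStarRing.star_mul_self_eq_zero_iff _).mp (by rw [hwB]; exact h0)
  have hle : a₀ ≤ ‖(w : B) * star (w : B)‖ • ((h : B) * h) := by
    have := CStarAlgebra.star_left_conjugate_le_norm_smul (a := (h : B))
      (b := (w : B) * star (w : B)) (IsSelfAdjoint.mul_star_self _)
    rw [show star (h : B) = h from congrArg Subtype.val hh] at this
    convert this using 1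
    calc a₀ = ((h * w : A) : B) * star ((h * w : A) : B) := by rw [hwB]
      _ = h * w * (star (w : B) * star (h : B)) := by simp
      _ = _ := by
        rw [show star (h : B) = h from congrArg Subtype.val hh]
        simp only [mul_assoc]
  have ha₀D : a₀ ∈ D := by
    refine hDher a₀ (h * w * (h * w) : A).2 _ ?_ ha₀_nonneg hle
    rw [← Complex.coe_smul]
    exact SMulMemClass.smul_mem _ (mul_mem hD hD)
  set c : ℝ := ‖a₀‖⁻¹ with hc
  have hmem : ((c : ℂ) • a₀) * x * ((c : ℂ) • a₀) ∈ A := by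
    have := SMulMemClass.smul_mem ((c : ℂ) * c) (hwx (h * w))
    convert this using 1
    simp only [mul_smul_comm, smul_mul_assoc, smul_smul, ha₀, mul_assoc,
      NonUnitalStarSubalgebra.coe_mul]
  have hnorm : ‖(c : ℂ) • a₀‖ = 1 := by
    rw [norm_smul, hc]
    simp [ha₀_ne]
  refine ⟨(c : ℂ) • a₀, SMulMemClass.smul_mem _ ha₀D, ?_, hnorm, ?_⟩
  · rw [Complex.coe_smul]
    exact smul_nonneg (by positivity) ha₀_nonneg
  · refine (Metric.infDist_le_dist_of_mem hmem).trans_lt (lt_of_le_of_lt ?_ hbx)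
    rw [dist_eq_norm, dist_eq_norm, ← sub_mul, ← mul_sub]
    refine (norm_mul_le _ _).trans ?_
    rw [hnorm, mul_one]
    refine (norm_mul_le _ _).trans ?_
    rw [hnorm, one_mul]
end

section
/- Let A ⊆ B be a regular masa inclusion of C*-algebras, let n ∈ N(A,B) be a normaliser, let M_n be the closed linear span of {a n a' : a, a' ∈ A} (the slice generated by n), and let (M_n ∩ A)^⊥ := {a ∈ A : a c = 0 for all c ∈ M_n ∩ A}. Then the closed linear span of the set of products {m c : m ∈ M_n, c ∈ (M_n ∩ A)^⊥} is an aperiodic A-bimodule: for every element y of this closed span, every ε > 0 and every nonzero hereditary C*-subalgebra D ⊆ A, there exists a positive a ∈ D with ‖a‖ = 1 and ‖a y a‖ < ε. -/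
open WeakDual in
theorem exists_character_ne_zero {A : Type*} [NonUnitalCommCStarAlgebra A] {h : A} (hh : h ≠ 0) :
    ∃ φ : A →⋆ₙₐ[ℂ] ℂ, φ h ≠ 0 := by
  have h1 : gelfandTransform ℂ (Unitization ℂ A) (h : Unitization ℂ A) ≠ 0 := by
    intro h0
    apply hh
    have := (gelfandTransform_isometry (Unitization ℂ A)).injective (h0.trans (map_zero _).symm)
    exact Unitization.inr_injective (this.trans (Unitization.inr_zero ℂ).symm)
  obtain ⟨χ, hχ⟩ : ∃ χ, gelfandTransform ℂ (Unitization ℂ A) (h : Unitization ℂ A) χ ≠ 0 := by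
    by_contra! hc
    exact h1 (ContinuousMap.ext hc)
  refine ⟨(NonUnitalStarAlgHomClass.toNonUnitalStarAlgHom χ).comp
    (Unitization.inrNonUnitalStarAlgHom ℂ A), ?_⟩
  simpa using hχ

open WeakDual in
theorem exists_mul_eq_zero_of_character_ne {A : Type*} [NonUnitalCommCStarAlgebra A]
    {φ ψ : A →ₙₐ[ℂ] ℂ} (hne : φ ≠ ψ) (hφ : ∃ a, φ a ≠ 0) (hψ : ∃ a, ψ a ≠ 0) :
    ∃ f g : A, f * g = 0 ∧ φ f ≠ 0 ∧ ψ g ≠ 0 := by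
  obtain ⟨p, hp⟩ := hφ
  obtain ⟨q, hq⟩ := hψ
  let Φ : characterSpace ℂ (Unitization ℂ A) :=
    CharacterSpace.equivAlgHom.symm (Unitization.lift φ)
  let Ψ : characterSpace ℂ (Unitization ℂ A) :=
    CharacterSpace.equivAlgHom.symm (Unitization.lift ψ)
  have hΦ (a : A) : Φ (a : Unitization ℂ A) = φ a := by
    simp [Φ]
  have hΨ (a : A) : Ψ (a : Unitization ℂ A) = ψ a := by
    simp [Ψ]
  have hne' : Φ ≠ Ψ := fun h => hne (by ext a; rw [← hΦ, ← hΨ, h])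
  obtain ⟨U, V, hU, hV, hΦU, hΨV, hUV⟩ := t2_separation hne'
  obtain ⟨F, hF0, hF1, -⟩ := exists_continuous_zero_one_of_isClosed hU.isClosed_compl
    (isClosed_singleton (x := Φ)) (by simpa using hΦU)
  obtain ⟨G, hG0, hG1, -⟩ := exists_continuous_zero_one_of_isClosed hV.isClosed_compl
    (isClosed_singleton (x := Ψ)) (by simpa using hΨV)
  let e := gelfandStarTransform (Unitization ℂ A)
  let F' : C(characterSpace ℂ (Unitization ℂ A), ℂ) := ⟨fun x => (F x : ℂ), by fun_prop⟩
  let G' : C(characterSpace ℂ (Unitization ℂ A), ℂ) := ⟨fun x => (G x : ℂ), by fun_prop⟩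
  have hFG : F' * G' = 0 := by
    ext x
    by_cases hx : x ∈ U
    · have : G x = 0 := hG0 (Set.disjoint_left.1 hUV hx)
      simp [F', G', this]
    · have : F x = 0 := hF0 hx
      simp [F', G', this]
  have key (H : C(characterSpace ℂ (Unitization ℂ A), ℂ)) (χ) : χ (e.symm H) = H χ := by
    conv_rhs => rw [← e.apply_symm_apply H]
    rfl
  have inr_snd (x : Unitization ℂ A) (a : A) :
      (((x * (a : Unitization ℂ A)).snd : A) : Unitization ℂ A) = x * a := by
    ext <;> simp
  refine ⟨(e.symm F' * (p : Unitization ℂ A)).snd, (e.symm G' * (q : Unitization ℂ A)).snd,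
    ?_, ?_, ?_⟩
  · apply Unitization.inr_injective (R := ℂ)
    rw [Unitization.inr_mul, inr_snd, inr_snd, mul_mul_mul_comm, ← map_mul, hFG]
    simp
  · rw [← hΦ, inr_snd, map_mul, key, hΦ]
    have : F Φ = 1 := hF1 rfl
    simpa [F', this] using hp
  · rw [← hΨ, inr_snd, map_mul, key, hΨ]
    have : G Ψ = 1 := hG1 rfl
    simpa [G', this] using hq

theorem exists_mul_eq_zero_and_mul_mul_ne_zero {B C : Type*} [NonUnitalCStarAlgebra B]
    [NonUnitalCommCStarAlgebra C] {ι : C →⋆ₙₐ[ℂ] B} (hι : Function.Injective ι) {T : B}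
    (hT : ∀ a, ∃ c, ι c = star T * ι a * T) {s r : C} (hs : ι s = star T * T)
    (hr : ι r = T * star T) {b : C} (hb : T * ι b ≠ ι b * T) :
    ∃ f g : C, f * g = 0 ∧ ι g * T * ι f ≠ 0 := by
  choose τ hτ using hT
  have τ_add (x y : C) : τ (x + y) = τ x + τ y := hι (by simp [hτ, mul_add, add_mul])
  have τ_smul (c : ℂ) (x : C) : τ (c • x) = c • τ x := hι (by simp [hτ, mul_smul_comm, smul_mul_assoc])
  have τ_zero : τ 0 = 0 := hι (by simp [hτ])
  have τ_mul (x y : C) : τ x * τ y = τ (x * y) * s := by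
    apply hι
    have hc : ι r * ι y = ι y * ι r := by rw [← map_mul, ← map_mul, mul_comm]
    rw [hr] at hc
    simp only [map_mul, hτ, hs]
    calc star T * ι x * T * (star T * ι y * T)
        = star T * ι x * ((T * star T) * ι y) * T := by simp only [mul_assoc]
      _ = _ := by rw [hc]; simp only [mul_assoc]
  have τ_r : τ r = s * s := hι (by simp [hτ, hs, hr, mul_assoc])
  let h : C := star b * s * b - star b * τ b - τ (star b) * b + τ (star b * b)
  have hh : ι h = star (T * ι b - ι b * T) * (T * ι b - ι b * T) := by
    simp only [h, map_add, map_sub, map_mul, map_star, hτ, hs, star_sub, star_mul, sub_mul, mul_sub,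
      mul_assoc]
    abel
  have hh0 : h ≠ 0 := by
    intro h0
    rw [h0, map_zero, eq_comm, CStarRing.star_mul_self_eq_zero_iff, sub_eq_zero] at hh
    exact hb hh
  obtain ⟨φ, hφ⟩ := exists_character_ne_zero hh0
  have φ_τ_mul (x y : C) : φ (τ x) * φ (τ y) = φ (τ (x * y)) * φ s := by
    rw [← map_mul, τ_mul, map_mul]
  have ht : φ s ≠ 0 := by
    intro ht
    have hz (x : C) : φ (τ x) = 0 := by
      have := φ_τ_mul x x
      rw [ht, mul_zero] at this
      exact mul_self_eq_zero.1 this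
    apply hφ
    simp [h, ht, hz]
  let ψ : C →ₙₐ[ℂ] ℂ :=
    { toFun x := φ (τ x) / φ s
      map_smul' c x := by simp [τ_smul, mul_div_assoc]
      map_zero' := by simp [τ_zero]
      map_add' x y := by simp [τ_add, add_div]
      map_mul' x y := by
        have := φ_τ_mul x y
        field_simp
        linear_combination -this }
  have hψ (x : C) : φ (τ x) = ψ x * φ s := (div_mul_cancel₀ _ ht).symm
  have hne : φ.toNonUnitalAlgHom ≠ ψ := by
    intro he
    have he' (x : C) : ψ x = φ x := (DFunLike.congr_fun he x).symm
    apply hφ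
    simp only [h, map_add, map_sub, map_mul, hψ, he']
    ring
  obtain ⟨f, g, hfg, hf, hg⟩ := exists_mul_eq_zero_of_character_ne hne ⟨h, hφ⟩
    ⟨r, by simpa [ψ, τ_r] using ht⟩
  refine ⟨f, g, hfg, fun h0 => ?_⟩
  have hz : star f * τ (star g * g) * f = 0 := hι <| by
    calc ι (star f * τ (star g * g) * f) = star (ι g * T * ι f) * (ι g * T * ι f) := by
          simp only [map_mul, map_star, hτ, star_mul, mul_assoc]
      _ = ι 0 := by rw [h0, mul_zero, map_zero]
  replace hf : φ f ≠ 0 := hf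
  by_cases hg0 : ψ (star g) = 0
  · have hg' : φ (τ (star g)) = 0 := by rw [hψ, hg0, zero_mul]
    have : τ (star g) = star (τ g) := hι (by simp [hτ, map_star, mul_assoc])
    rw [this, map_star, star_eq_zero, hψ] at hg'
    exact mul_ne_zero hg ht hg'
  · have := congrArg φ hz
    simp only [map_mul, hψ, map_star, map_zero, mul_eq_zero, star_eq_zero] at this
    tauto

theorem IsNormalizer.conjugate_mul_mul_eq_zero {B : Type*} [NonUnitalCStarAlgebra B]
    {A : NonUnitalStarSubalgebra ℂ B} (hAcomm : ∀ a ∈ A, ∀ a' ∈ A, a * a' = a' * a)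
    {n : B} (hn : IsNormalizer A n) {d f g : B} (hd : d ∈ A) (hf : f ∈ A) (hg : g ∈ A)
    (hfg : f * g = 0) :
    star (g * (d * n * d) * f) * (g * (d * n * d) * f) * n *
      (star (g * (d * n * d) * f) * (g * (d * n * d) * f)) = 0 := by
  have hd' := star_mem hd
  have hf' := star_mem hf
  have hg' := star_mem hg
  set v := star d * star g * g * d with hv
  have hvA : v ∈ A := mul_mem (mul_mem (mul_mem hd' hg') hg) hd
  set w := star f * star d * d * f with hw
  have hwA : w ∈ A := mul_mem (mul_mem (mul_mem hf' hd') hd) hf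
  have hfv : f * v = 0 := by
    rw [hAcomm f hf v hvA, hv, mul_assoc _ d, hAcomm d hd f hf, mul_assoc _ g,
      ← mul_assoc g, hAcomm g hg f hf, hfg, zero_mul, mul_zero]
  set u := star n * v * n with hu
  have huA : u ∈ A := hn.1 v hvA
  have hz : star (g * (d * n * d) * f) * (g * (d * n * d) * f) = w * u := by
    calc _ = star f * star d * (u * (d * f)) := by
          simp only [hu, hv, star_mul, mul_assoc]
      _ = _ := by rw [hAcomm u huA _ (mul_mem hd hf), hw]; simp only [mul_assoc]
  have hleft : f * n * (w * u) = 0 := by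
    have hnw : n * w * star n ∈ A := hn.2 w hwA
    calc f * n * (w * u) = f * ((n * w * star n) * v) * n := by simp only [hu, mul_assoc]
      _ = 0 := by
        rw [hAcomm _ hnw v hvA, ← mul_assoc f, hfv, zero_mul, zero_mul]
  have hwu : w * u = u * (star f * star d * d) * f := by
    rw [hAcomm w hwA u huA, hw]; simp only [mul_assoc]
  rw [hz]
  calc w * u * n * (w * u) = u * (star f * star d * d) * (f * n * (w * u)) := by
        nth_rewrite 1 [hwu]; simp only [mul_assoc]
    _ = 0 := by rw [hleft, mul_zero]

theorem IsNormalizer.exists_mul_mul_eq_zero_of_not_commute {B : Type*} [NonUnitalCStarAlgebra B]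
    {A : NonUnitalStarSubalgebra ℂ B} (hAclosed : IsClosed (A : Set B))
    (hAcomm : ∀ a ∈ A, ∀ a' ∈ A, a * a' = a' * a)
    {n : B} (hn : IsNormalizer A n) {d : B} (hd : d ∈ A) {b : B} (hb : b ∈ A)
    (hdb : d * n * d * b ≠ b * (d * n * d)) :
    ∃ f ∈ A, ∃ g ∈ A, g * (d * n * d) * f ≠ 0 ∧
      star (g * (d * n * d) * f) * (g * (d * n * d) * f) * n *
        (star (g * (d * n * d) * f) * (g * (d * n * d) * f)) = 0 := by
  have hd' := star_mem hd
  have := hAclosed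
  let _ : NonUnitalCommCStarAlgebra A :=
    { NonUnitalStarSubalgebra.nonUnitalCStarAlgebra A with
      mul_comm := fun x y => Subtype.ext (hAcomm x x.2 y y.2) }
  have hmem (x : B) (hx : x ∈ A) : star (d * n * d) * x * (d * n * d) ∈ A := by
    have : star (d * n * d) * x * (d * n * d) =
        star d * (star n * (star d * x * d) * n) * d := by simp only [star_mul, mul_assoc]
    rw [this]
    exact mul_mem (mul_mem hd' (hn.1 _ (mul_mem (mul_mem hd' hx) hd))) hd
  have hs : star (d * n * d) * (d * n * d) ∈ A := by
    have : star (d * n * d) * (d * n * d) =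
        star d * (star n * (star d * d) * n) * d := by simp only [star_mul, mul_assoc]
    rw [this]
    exact mul_mem (mul_mem hd' (hn.1 _ (mul_mem hd' hd))) hd
  have hr : d * n * d * star (d * n * d) ∈ A := by
    have : d * n * d * star (d * n * d) =
        d * (n * (d * star d) * star n) * star d := by simp only [star_mul, mul_assoc]
    rw [this]
    exact mul_mem (mul_mem hd (hn.2 _ (mul_mem hd hd'))) hd'
  obtain ⟨f, g, hfg, hne⟩ := exists_mul_eq_zero_and_mul_mul_ne_zero
    (ι := NonUnitalStarSubalgebraClass.subtype A) Subtype.val_injective (T := d * n * d)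
    (fun a => ⟨⟨_, hmem a a.2⟩, rfl⟩) (s := ⟨_, hs⟩) (r := ⟨_, hr⟩) rfl rfl (b := ⟨b, hb⟩) hdb
  exact ⟨f, f.2, g, g.2, hne,
    hn.conjugate_mul_mul_eq_zero hAcomm hd f.2 g.2 (congrArg Subtype.val hfg)⟩

theorem mul_mul_mem_of_hereditary {B : Type*} [NonUnitalCStarAlgebra B] [PartialOrder B]
    [StarOrderedRing B] {A D : NonUnitalStarSubalgebra ℂ B}
    (hD : ∀ a ∈ A, ∀ d ∈ D, 0 ≤ a → a ≤ d → a ∈ D) {d k : B} (hd : d ∈ D) (hk : 0 ≤ k)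
    (hdk : star d * k * d ∈ A) : star d * k * d ∈ D :=
  hD _ hdk _ (SMulMemClass.smul_mem (‖k‖ : ℂ) (mul_mem (star_mem hd) hd))
    (star_left_conjugate_nonneg hk d) <| by
      have := CStarAlgebra.star_left_conjugate_le_norm_smul (a := d) (b := k) hk.isSelfAdjoint
      rwa [← Complex.coe_smul] at this

theorem mul_mul_eq_zero_of_mem_closure_span {B : Type*} [NonUnitalCStarAlgebra B] {S : Set B}
    {p q : B} (hS : ∀ x ∈ S, p * x * q = 0) {y : B}
    (hy : y ∈ closure (Submodule.span ℂ S : Set B)) : p * y * q = 0 := by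
  have hspan : (Submodule.span ℂ S : Set B) ⊆ {x | p * x * q = 0} := by
    intro x hx
    induction hx using Submodule.span_induction with
    | mem x hx => exact hS x hx
    | zero => simp
    | add x y _ _ hx hy =>
      simp only [Set.mem_ofPred_eq] at hx hy ⊢
      rw [mul_add, add_mul, hx, hy, add_zero]
    | smul c x _ hx =>
      simp only [Set.mem_ofPred_eq] at hx ⊢
      rw [mul_smul_comm, smul_mul_assoc, hx, smul_zero]
  exact closure_minimal hspan (isClosed_eq (by fun_prop) continuous_const) hy

theorem exists_norm_eq_one_of_mul_mul_eq_zero {B : Type*} [NonUnitalCStarAlgebra B]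
    [PartialOrder B] [StarOrderedRing B] {D : NonUnitalStarSubalgebra ℂ B} {S : Set B} {a : B}
    (haD : a ∈ D) (ha : 0 ≤ a) (ha0 : a ≠ 0) (hS : ∀ x ∈ S, a * x * a = 0) {y : B}
    (hy : y ∈ closure (Submodule.span ℂ S : Set B)) :
    ∃ a ∈ D, 0 ≤ a ∧ ‖a‖ = 1 ∧ a * y * a = 0 := by
  have hy0 : a * y * a = 0 := mul_mul_eq_zero_of_mem_closure_span hS hy
  have hn : ‖a‖ ≠ 0 := norm_ne_zero_iff.2 ha0
  refine ⟨((‖a‖⁻¹ : ℝ) : ℂ) • a, SMulMemClass.smul_mem _ haD, ?_, ?_, ?_⟩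
  · rw [Complex.coe_smul]
    exact smul_nonneg (by positivity) ha
  · rw [norm_smul, Complex.norm_real, norm_inv, norm_norm, inv_mul_cancel₀ hn]
  · rw [smul_mul_assoc, smul_mul_assoc, mul_smul_comm, hy0, smul_zero, smul_zero]

/-- Let `A ⊆ B` be a regular masa inclusion, `n` a normaliser,
`M_n` the closed linear span of `{a n a' : a, a' ∈ A}` and
`(M_n ∩ A)^⊥ = {a ∈ A : a c = 0 for all c ∈ M_n ∩ A}`.  Then the closed linear span of
`{m c : m ∈ M_n, c ∈ (M_n ∩ A)^⊥}` is an aperiodic `A`-bimodule. -/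
theorem stmt1 {B : Type*} [NonUnitalCStarAlgebra B] [PartialOrder B] [StarOrderedRing B]
    (A : NonUnitalStarSubalgebra ℂ B) (hAclosed : IsClosed (A : Set B))
    (hAcomm : ∀ a ∈ A, ∀ a' ∈ A, a * a' = a' * a)
    (hAmasa : ∀ b : B, (∀ a ∈ A, b * a = a * b) → b ∈ A)
    (hreg : closure (Submodule.span ℂ {m : B | IsNormalizer A m} : Set B) = Set.univ)
    (n : B) (hn : IsNormalizer A n)
    (Mn : Set B)
    (hMn : Mn = closure (Submodule.span ℂ
      {x : B | ∃ a ∈ A, ∃ a' ∈ A, x = a * n * a'} : Set B))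
    (perp : Set B)
    (hperp : perp = {a : B | a ∈ A ∧ ∀ c ∈ Mn ∩ (A : Set B), a * c = 0})
    (Y : Set B)
    (hY : Y = closure (Submodule.span ℂ
      {x : B | ∃ m ∈ Mn, ∃ c ∈ perp, x = m * c} : Set B)) :
    ∀ y ∈ Y, ∀ ε > (0 : ℝ),
      ∀ D : NonUnitalStarSubalgebra ℂ B, IsClosed (D : Set B) → (D : Set B) ⊆ A →
        (∀ a ∈ A, ∀ d ∈ D, 0 ≤ a → a ≤ d → a ∈ D) →
        (∃ d ∈ D, d ≠ 0) →
        ∃ a ∈ D, 0 ≤ a ∧ ‖a‖ = 1 ∧ ‖a * y * a‖ < ε := by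
  subst hMn hperp hY
  intro y hy ε hε D _ hDA hD ⟨e, he, he0⟩
  suffices h : ∃ a ∈ D, 0 ≤ a ∧ a ≠ 0 ∧
      ∀ m ∈ closure (Submodule.span ℂ {x : B | ∃ a ∈ A, ∃ a' ∈ A, x = a * n * a'} : Set B),
        ∀ c ∈ {a : B | a ∈ A ∧ ∀ c ∈ closure (Submodule.span ℂ
          {x : B | ∃ a ∈ A, ∃ a' ∈ A, x = a * n * a'} : Set B) ∩ (A : Set B), a * c = 0},
          a * (m * c) * a = 0 by
    obtain ⟨a, haD, ha, ha0, h⟩ := h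
    obtain ⟨a', ha'D, ha', hn', h0⟩ := exists_norm_eq_one_of_mul_mul_eq_zero haD ha ha0
      (by rintro _ ⟨m, hm, c, hc, rfl⟩; exact h m hm c hc) hy
    exact ⟨a', ha'D, ha', hn', by rwa [h0, norm_zero]⟩
  have of_compression (a : B) (haA : a ∈ A) (han : a * n * a = 0) (m : B)
      (hm : m ∈ closure (Submodule.span ℂ {x : B | ∃ a ∈ A, ∃ a' ∈ A, x = a * n * a'} : Set B))
      (c : B) (hc : c ∈ A) : a * (m * c) * a = 0 := by
    rw [← mul_assoc, mul_assoc _ c]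
    refine mul_mul_eq_zero_of_mem_closure_span ?_ hm
    rintro _ ⟨p, hp, q, hq, rfl⟩
    calc a * (p * n * q) * (c * a) = (a * p) * n * ((q * c) * a) := by simp only [mul_assoc]
      _ = p * (a * n * a) * (q * c) := by
        rw [hAcomm a haA p hp, hAcomm _ (mul_mem hq hc) a haA]; simp only [mul_assoc]
      _ = 0 := by rw [han, mul_zero, zero_mul]
  set d := star e * e with hd_def
  have hdD : d ∈ D := mul_mem (star_mem he) he
  have hdA : d ∈ A := hDA hdD
  have hd_nonneg : 0 ≤ d := star_mul_self_nonneg e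
  have hd_star : star d = d := hd_nonneg.isSelfAdjoint
  have hd0 : d ≠ 0 := fun h => he0 (CStarRing.star_mul_self_eq_zero_iff e |>.1 h)
  by_cases hcomm : ∀ b ∈ A, d * n * d * b = b * (d * n * d)
  · have hTA : d * n * d ∈ A := hAmasa _ hcomm
    by_cases hT0 : d * n * d = 0
    · exact ⟨d, hdD, hd_nonneg, hd0, fun m hm c hc => of_compression d hdA hT0 m hm c hc.1⟩
    · have hTM : d * n * d ∈ closure
          (Submodule.span ℂ {x : B | ∃ a ∈ A, ∃ a' ∈ A, x = a * n * a'} : Set B) :=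
        subset_closure (Submodule.subset_span ⟨d, hdA, d, hdA, rfl⟩)
      have heq : star (d * n * d) * (d * n * d) =
          star d * (star (d * n) * (d * n)) * d := by
        simp only [star_mul, hd_star, mul_assoc]
      refine ⟨star (d * n * d) * (d * n * d), ?_, star_mul_self_nonneg _, ?_, ?_⟩
      · rw [heq]
        apply mul_mul_mem_of_hereditary hD hdD (star_mul_self_nonneg _)
        rw [← heq]
        exact mul_mem (star_mem hTA) hTA
      · rwa [Ne, CStarRing.star_mul_self_eq_zero_iff]
      · rintro m - c ⟨hcA, hc⟩
        have h0 : c * (star (d * n * d) * (d * n * d)) = 0 := by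
          rw [hAcomm _ (star_mem hTA) _ hTA, ← mul_assoc, hc _ ⟨hTM, hTA⟩, zero_mul]
        rw [mul_assoc _ (m * c), mul_assoc m c, h0, mul_zero, mul_zero]
  · push Not at hcomm
    obtain ⟨b, hb, hdb⟩ := hcomm
    obtain ⟨f, hf, g, hg, hne, hz⟩ :=
      hn.exists_mul_mul_eq_zero_of_not_commute hAclosed hAcomm hdA hb hdb
    have hzeq : star (g * (d * n * d) * f) * (g * (d * n * d) * f) =
        star d * (star (g * d * n * f) * (g * d * n * f)) * d := by
      have : g * (d * n * d) * f = g * d * n * f * d := by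
        simp only [mul_assoc]; rw [hAcomm d hdA f hf]
      rw [this]; simp only [star_mul, mul_assoc]
    have hzA : star (g * (d * n * d) * f) * (g * (d * n * d) * f) ∈ A := by
      have : star (g * (d * n * d) * f) * (g * (d * n * d) * f) = star f * star d *
          (star n * (star d * star g * g * d) * n) * (d * f) := by
        simp only [star_mul, mul_assoc]
      rw [this]
      exact mul_mem (mul_mem (mul_mem (star_mem hf) (star_mem hdA)) (hn.1 _
        (mul_mem (mul_mem (mul_mem (star_mem hdA) (star_mem hg)) hg) hdA))) (mul_mem hdA hf)
    refine ⟨_, ?_, star_mul_self_nonneg _, ?_, fun m hm c hc => of_compression _ hzA hz m hm c hc.1⟩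
    · rw [hzeq]
      exact mul_mul_mem_of_hereditary hD hdD (star_mul_self_nonneg _) (hzeq ▸ hzA)
    · rwa [Ne, CStarRing.star_mul_self_eq_zero_iff]
end

section
/- Let A ⊆ B be a non-degenerate inclusion of C*-algebras. Suppose there is a collection 𝒮 of slices for the inclusion A ⊆ B such that the linear span of the union of the members of 𝒮 is dense in B, and such that for every W ∈ 𝒮 the closed linear span of {w c : w ∈ W, c ∈ (W ∩ A)^⊥} is an aperiodic A-bimodule, where (W ∩ A)^⊥ := {a ∈ A : a c = 0 and c a = 0 for all c ∈ W ∩ A}. Then the inclusion A ⊆ B is aperiodic: for every b ∈ B, every ε > 0 and every nonzero hereditary C*-subalgebra D ⊆ A, there exists a positive a ∈ D with ‖a‖ = 1 such that dist(a b a, A) < ε, where dist denotes distance in the norm of B. -/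
/-- A slice for the inclusion `A ⊆ B`: a closed linear subspace of `B` consisting of
normalisers, with `A W + W A ⊆ W` and `W* W + W W* ⊆ A`. -/
def IsSlice {B : Type*} [NonUnitalCStarAlgebra B]
    (A : NonUnitalStarSubalgebra ℂ B) (W : Submodule ℂ B) : Prop :=
  IsClosed (W : Set B) ∧ (∀ w ∈ W, IsNormalizer A w) ∧
    (∀ a ∈ A, ∀ w ∈ W, a * w ∈ W ∧ w * a ∈ W) ∧
    (∀ v ∈ W, ∀ w ∈ W, star v * w ∈ A ∧ v * star w ∈ A)

/-- A nonzero closed hereditary star-subalgebra of `A`. -/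
structure IsNonzeroHereditary {B : Type*} [NonUnitalCStarAlgebra B] [PartialOrder B]
    (A D : NonUnitalStarSubalgebra ℂ B) : Prop where
  isClosed : IsClosed (D : Set B)
  subset : (D : Set B) ⊆ A
  mem_of_le : ∀ a ∈ A, ∀ d ∈ D, 0 ≤ a → a ≤ d → a ∈ D
  exists_ne_zero : ∃ d ∈ D, d ≠ 0

/-- The elements `b` of `B` such that every nonzero hereditary subalgebra of `A` contains
positive contractions `a` of norm one with `a b a` arbitrarily close to `A`. -/
def IsAperiodicMod {B : Type*} [NonUnitalCStarAlgebra B] [PartialOrder B]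
    (A : NonUnitalStarSubalgebra ℂ B) (b : B) : Prop :=
  ∀ ε > (0 : ℝ), ∀ D : NonUnitalStarSubalgebra ℂ B, IsNonzeroHereditary A D →
    ∃ a ∈ D, 0 ≤ a ∧ ‖a‖ = 1 ∧ ∃ α ∈ A, ‖a * b * a - α‖ < ε

section

variable {B : Type*} [NonUnitalCStarAlgebra B]

/-- The elements of `D` on which the self-adjoint element `g` acts as a two-sided unit. -/
def fixedBy (D : NonUnitalStarSubalgebra ℂ B) (g : B) (hg : IsSelfAdjoint g) :
    NonUnitalStarSubalgebra ℂ B where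
  carrier := {x | x ∈ D ∧ g * x = x ∧ x * g = x}
  add_mem' := fun hx hy => ⟨add_mem hx.1 hy.1, by rw [mul_add, hx.2.1, hy.2.1],
    by rw [add_mul, hx.2.2, hy.2.2]⟩
  zero_mem' := ⟨zero_mem D, mul_zero g, zero_mul g⟩
  mul_mem' := fun hx hy => ⟨mul_mem hx.1 hy.1, by rw [← mul_assoc, hx.2.1],
    by rw [mul_assoc, hy.2.2]⟩
  smul_mem' := fun c x hx => ⟨SMulMemClass.smul_mem c hx.1, by rw [mul_smul_comm, hx.2.1],
    by rw [smul_mul_assoc, hx.2.2]⟩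
  star_mem' := fun {x} hx => ⟨star_mem hx.1,
    by simpa [hg.star_eq] using congrArg star hx.2.2,
    by simpa [hg.star_eq] using congrArg star hx.2.1⟩

lemma mem_fixedBy {D : NonUnitalStarSubalgebra ℂ B} {g : B} {hg : IsSelfAdjoint g} {x : B} :
    x ∈ fixedBy D g hg ↔ x ∈ D ∧ g * x = x ∧ x * g = x := Iff.rfl

lemma isClosed_fixedBy {D : NonUnitalStarSubalgebra ℂ B} (hD : IsClosed (D : Set B))
    (g : B) (hg : IsSelfAdjoint g) : IsClosed (fixedBy D g hg : Set B) :=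
  hD.inter ((isClosed_eq (by fun_prop) continuous_id).inter
    (isClosed_eq (by fun_prop) continuous_id))

lemma exists_norm_eq_one {S : Submodule ℂ B} (h : ∃ d ∈ S, d ≠ 0) : ∃ z ∈ S, ‖z‖ = 1 := by
  obtain ⟨d, hd, hd0⟩ := h
  refine ⟨((‖d‖⁻¹ : ℝ) : ℂ) • d, S.smul_mem _ hd, ?_⟩
  rw [norm_smul, Complex.norm_real, norm_inv, norm_norm, inv_mul_cancel₀ (norm_ne_zero_iff.2 hd0)]

lemma norm_conj_sub_conj_le {a e : B} {δ : ℝ} (ha : ‖a‖ ≤ 1) (y : B)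
    (h : ‖e * a - a‖ ≤ δ) : ‖a * y * a - a * (y * e) * a‖ ≤ δ * ‖y‖ := by
  have : a * y * a - a * (y * e) * a = -(a * y * (e * a - a)) := by noncomm_ring
  rw [this, norm_neg]
  calc ‖a * y * (e * a - a)‖ ≤ ‖a * y‖ * ‖e * a - a‖ := norm_mul_le _ _
    _ ≤ (‖a‖ * ‖y‖) * ‖e * a - a‖ := by gcongr; exact norm_mul_le _ _
    _ ≤ (1 * ‖y‖) * δ := by gcongr
    _ = δ * ‖y‖ := by ring

lemma norm_conj_sub_conj_conj_le {a e : B} {δ : ℝ} (ha : ‖a‖ ≤ 1) (he : ‖e‖ ≤ 1) (y : B)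
    (hl : ‖e * a - a‖ ≤ δ) (hr : ‖a * e - a‖ ≤ δ) :
    ‖a * y * a - a * (e * y * e) * a‖ ≤ 2 * δ * ‖y‖ := by
  have h₁ := norm_conj_sub_conj_le ha y hl
  have : a * (y * e) * a - a * (e * y * e) * a = -((a * e - a) * y * (e * a)) := by noncomm_ring
  have hea : ‖e * a‖ ≤ 1 := (norm_mul_le _ _).trans (mul_le_one₀ he (norm_nonneg _) ha)
  have hδ : 0 ≤ δ := (norm_nonneg _).trans hl
  have h₂ : ‖a * (y * e) * a - a * (e * y * e) * a‖ ≤ δ * ‖y‖ := by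
    rw [this, norm_neg]
    calc ‖(a * e - a) * y * (e * a)‖ ≤ ‖(a * e - a) * y‖ * ‖e * a‖ := norm_mul_le _ _
      _ ≤ (‖a * e - a‖ * ‖y‖) * ‖e * a‖ := by gcongr; exact norm_mul_le _ _
      _ ≤ (δ * ‖y‖) * 1 := by gcongr
      _ = δ * ‖y‖ := by ring
  calc _ ≤ ‖a * y * a - a * (y * e) * a‖ + ‖a * (y * e) * a - a * (e * y * e) * a‖ :=
        norm_sub_le_norm_sub_add_norm_sub _ _ _
    _ ≤ δ * ‖y‖ + δ * ‖y‖ := add_le_add h₁ h₂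
    _ = 2 * δ * ‖y‖ := by ring

variable [PartialOrder B]

lemma IsAperiodicMod.smul {A : NonUnitalStarSubalgebra ℂ B} {y : B} (hy : IsAperiodicMod A y)
    (c : ℂ) : IsAperiodicMod A (c • y) := by
  intro ε hε D hD
  obtain ⟨a, ha, ha0, ha1, α, hα, hlt⟩ := hy (ε / (‖c‖ + 1)) (by positivity) D hD
  refine ⟨a, ha, ha0, ha1, c • α, SMulMemClass.smul_mem c hα, ?_⟩
  rw [mul_smul_comm, smul_mul_assoc, ← smul_sub, norm_smul]
  rw [lt_div_iff₀ (by positivity)] at hlt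
  nlinarith [norm_nonneg (a * y * a - α)]

lemma isAperiodicMod_of_mem_closure {A : NonUnitalStarSubalgebra ℂ B} {S : Set B}
    (hS : ∀ y ∈ S, IsAperiodicMod A y) {b : B} (hb : b ∈ closure S) : IsAperiodicMod A b := by
  intro ε hε D hD
  obtain ⟨y, hy, hby⟩ := Metric.mem_closure_iff.1 hb (ε / 2) (by positivity)
  obtain ⟨a, ha, ha0, ha1, α, hα, hlt⟩ := hS y hy (ε / 2) (by positivity) D hD
  refine ⟨a, ha, ha0, ha1, α, hα, ?_⟩
  have h₁ : ‖a * (b - y) * a‖ ≤ ‖b - y‖ := by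
    calc _ ≤ ‖a * (b - y)‖ * ‖a‖ := norm_mul_le _ _
      _ ≤ (‖a‖ * ‖b - y‖) * ‖a‖ := by gcongr; exact norm_mul_le _ _
      _ = _ := by rw [ha1, one_mul, mul_one]
  rw [dist_eq_norm] at hby
  have : a * b * a - α = a * (b - y) * a + (a * y * a - α) := by noncomm_ring
  rw [this]
  refine (norm_add_le _ _).trans_lt ?_
  linarith

variable [StarOrderedRing B]

lemma mul_eq_self_of_nonneg_of_le {g x y : B} (hg : IsSelfAdjoint g) (hx : 0 ≤ x)
    (hxy : x ≤ y) (hy : y * g = y) : x * g = x := by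
  obtain ⟨s, rfl⟩ := CStarAlgebra.nonneg_iff_eq_star_mul_self.1 hx
  obtain ⟨r, hr⟩ := CStarAlgebra.nonneg_iff_eq_star_mul_self.1 (sub_nonneg.2 hxy)
  have key : star (s - s * g) * (s - s * g) + star (r - r * g) * (r - r * g) = 0 := by
    have : star (s - s * g) * (s - s * g) + star (r - r * g) * (r - r * g)
        = (star s * s + star r * r) - (star s * s + star r * r) * g
          - g * ((star s * s + star r * r) - (star s * s + star r * r) * g) := by
      simp only [star_sub, star_mul, hg.star_eq]
      noncomm_ring
    rw [this, ← hr, add_sub_cancel, hy]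
    simp
  have h0 : star (s - s * g) * (s - s * g) = 0 :=
    (add_eq_zero_iff_of_nonneg (star_mul_self_nonneg _) (star_mul_self_nonneg _)).1 key |>.1
  rw [CStarRing.star_mul_self_eq_zero_iff, sub_eq_zero] at h0
  rw [mul_assoc, ← h0]

lemma IsNonzeroHereditary.exists_nonneg_norm_eq_one {A D : NonUnitalStarSubalgebra ℂ B}
    (hD : IsNonzeroHereditary A D) : ∃ a ∈ D, 0 ≤ a ∧ ‖a‖ = 1 := by
  obtain ⟨z, hz, hz1⟩ := exists_norm_eq_one (S := D.toSubmodule) hD.exists_ne_zero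
  exact ⟨star z * z, mul_mem (star_mem hz) hz, star_mul_self_nonneg z,
    by rw [CStarRing.norm_star_mul_self, hz1, one_mul]⟩

lemma IsNonzeroHereditary.fixedBy {A D : NonUnitalStarSubalgebra ℂ B}
    (hD : IsNonzeroHereditary A D) {g : B} (hg : IsSelfAdjoint g)
    (h : ∃ d ∈ D, g * d = d ∧ d * g = d ∧ d ≠ 0) : IsNonzeroHereditary A (fixedBy D g hg) where
  isClosed := isClosed_fixedBy hD.isClosed g hg
  subset := fun _ hx => hD.subset hx.1
  mem_of_le := fun a ha d hd ha0 had => by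
    have hag : a * g = a := mul_eq_self_of_nonneg_of_le hg ha0 had hd.2.2
    refine ⟨hD.mem_of_le a ha d hd.1 ha0 had, ?_, hag⟩
    simpa [hg.star_eq, (IsSelfAdjoint.of_nonneg ha0).star_eq] using congrArg star hag
  exists_ne_zero := h.imp fun _ hd => ⟨⟨hd.1, hd.2.1, hd.2.2.1⟩, hd.2.2.2⟩

/-- Near a positive norm-one element `e` of a hereditary subalgebra there is a smaller
hereditary subalgebra on whose unit ball `e` is almost a unit. -/
lemma IsNonzeroHereditary.exists_almost_fixed {A D : NonUnitalStarSubalgebra ℂ B}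
    (hD : IsNonzeroHereditary A D) {e : B} (he : e ∈ D) (he0 : 0 ≤ e) (he1 : ‖e‖ = 1)
    {δ : ℝ} (hδ : 0 < δ) :
    ∃ D' : NonUnitalStarSubalgebra ℂ B, IsNonzeroHereditary A D' ∧ (D' : Set B) ⊆ D ∧
      ∀ x ∈ D', ‖x‖ ≤ 1 → ‖e * x - x‖ ≤ δ ∧ ‖x * e - x‖ ≤ δ := by
  wlog hδ1 : δ < 1 generalizing δ
  · obtain ⟨D', h₁, h₂, h₃⟩ := this (δ := 1 / 2) (by norm_num) (by norm_num)
    refine ⟨D', h₁, h₂, fun x hx hx1 => ⟨(h₃ x hx hx1).1.trans ?_, (h₃ x hx hx1).2.trans ?_⟩⟩ <;>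
      linarith
  have hsa : IsSelfAdjoint e := .of_nonneg he0
  have h0 : ∀ t ∈ quasispectrum ℝ e, 0 ≤ t := quasispectrum_nonneg_of_nonneg e he0
  have h1 : ∀ t ∈ quasispectrum ℝ e, t ≤ 1 := fun t ht =>
    (le_abs_self t).trans
      (he1 ▸ NonUnitalIsometricContinuousFunctionalCalculus.norm_quasispectrum_le e ht)
  have h1mem : (1 : ℝ) ∈ quasispectrum ℝ e := by
    obtain ⟨t, ht, hte⟩ :=
      (NonUnitalIsometricContinuousFunctionalCalculus.isGreatest_norm_quasispectrum (𝕜 := ℝ) e).1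
    have : t = 1 := by
      have : ‖t‖ = 1 := hte.trans he1
      rwa [Real.norm_of_nonneg (h0 t ht)] at this
    rwa [← this]
  have hδ' : 0 < 1 - δ := by linarith
  set g : ℝ → ℝ := fun t => min 1 (t / (1 - δ)) with hgdef
  set f : ℝ → ℝ := fun t => max 0 (t - (1 - δ)) with hfdef
  have hgc : Continuous g := by fun_prop
  have hfc : Continuous f := by fun_prop
  have hg0 : g 0 = 0 := by simp [hgdef]
  have hf0 : f 0 = 0 := by simp [hfdef, hδ1.le]
  have hgf : ∀ t, g t * f t = f t := by
    intro t
    rcases le_total t (1 - δ) with ht | ht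
    · have : f t = 0 := max_eq_left (by linarith)
      rw [this, mul_zero]
    · have : g t = 1 := min_eq_left ((one_le_div hδ').2 ht)
      rw [this, one_mul]
  have hG : IsSelfAdjoint (cfcₙ g e) := cfcₙ_predicate g e
  have hmul : cfcₙ g e * cfcₙ f e = cfcₙ f e := by
    rw [← cfcₙ_mul g f e (by fun_prop) hg0 (by fun_prop) hf0]
    simp only [hgf]
  have hmul' : cfcₙ f e * cfcₙ g e = cfcₙ f e := by
    rw [← cfcₙ_mul f g e (by fun_prop) hf0 (by fun_prop) hg0]
    simp only [mul_comm (f _), hgf]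
  have hge : ‖e - cfcₙ g e‖ ≤ δ := by
    nth_rewrite 1 [← cfcₙ_id ℝ e]
    rw [← cfcₙ_sub id g e (by fun_prop) rfl (by fun_prop) hg0]
    refine norm_cfcₙ_le fun t ht => ?_
    have ht0 := h0 t ht
    have ht1 := h1 t ht
    have hle : t ≤ g t := le_min ht1 (le_div_self ht0 hδ' (by linarith))
    rw [id, Real.norm_of_nonpos (by linarith), neg_sub, sub_le_iff_le_add]
    rcases le_total t (1 - δ) with h | h
    · refine (min_le_right _ _).trans ?_
      rw [div_le_iff₀ hδ']
      nlinarith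
    · exact (min_le_left _ _).trans (by linarith)
  have hfmem : cfcₙ f e ∈ D := cfcₙ_mem (hs := hD.isClosed) f he
  have hfne : cfcₙ f e ≠ 0 := by
    have := norm_apply_le_norm_cfcₙ f e h1mem (by fun_prop) hf0
    have hf1 : f 1 = δ := by simp [hfdef, hδ.le]
    rw [hf1, Real.norm_of_nonneg hδ.le] at this
    exact norm_pos_iff.1 (hδ.trans_le this)
  refine ⟨_, hD.fixedBy hG ⟨_, hfmem, hmul, hmul', hfne⟩, fun x hx => hx.1, fun x hx hx1 => ?_⟩
  constructor
  · calc ‖e * x - x‖ = ‖(e - cfcₙ g e) * x‖ := by rw [sub_mul, hx.2.1]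
      _ ≤ ‖e - cfcₙ g e‖ * ‖x‖ := norm_mul_le _ _
      _ ≤ δ * 1 := by gcongr
      _ = δ := mul_one δ
  · calc ‖x * e - x‖ = ‖x * (e - cfcₙ g e)‖ := by rw [mul_sub, hx.2.2]
      _ ≤ ‖x‖ * ‖e - cfcₙ g e‖ := norm_mul_le _ _
      _ ≤ 1 * δ := by gcongr
      _ = δ := one_mul δ

lemma isAperiodicMod_zero (A : NonUnitalStarSubalgebra ℂ B) : IsAperiodicMod A 0 := by
  intro ε hε D hD
  obtain ⟨a, ha, ha0, ha1⟩ := hD.exists_nonneg_norm_eq_one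
  exact ⟨a, ha, ha0, ha1, 0, zero_mem A, by simpa using hε⟩

lemma IsAperiodicMod.add {A : NonUnitalStarSubalgebra ℂ B} {y z : B} (hy : IsAperiodicMod A y)
    (hz : IsAperiodicMod A z) : IsAperiodicMod A (y + z) := by
  intro ε hε D hD
  obtain ⟨e, he, he0, he1, α, hα, hαlt⟩ := hy (ε / 4) (by positivity) D hD
  obtain ⟨D', hD', hsub, hfix⟩ := hD.exists_almost_fixed he he0 he1
    (δ := ε / (8 * (‖y‖ + 1))) (by positivity)
  obtain ⟨a, ha, ha0, ha1, β, hβ, hβlt⟩ := hz (ε / 4) (by positivity) D' hD'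
  obtain ⟨hl, hr⟩ := hfix a ha ha1.le
  have haA : a ∈ A := hD'.subset ha
  refine ⟨a, hsub ha, ha0, ha1, a * α * a + β, add_mem (mul_mem (mul_mem haA hα) haA) hβ, ?_⟩
  have h₁ := norm_conj_sub_conj_conj_le ha1.le he1.le y hl hr
  have h₂ : 2 * (ε / (8 * (‖y‖ + 1))) * ‖y‖ ≤ ε / 4 := by
    have : 2 * (ε / (8 * (‖y‖ + 1))) * ‖y‖ = (ε / 4) * (‖y‖ / (‖y‖ + 1)) := by
      field_simp
      ring
    rw [this]
    refine mul_le_of_le_one_right (by positivity) ((div_le_one (by positivity)).2 (by linarith))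
  have h₃ : ‖a * (e * y * e - α) * a‖ ≤ ‖e * y * e - α‖ := by
    calc _ ≤ ‖a * (e * y * e - α)‖ * ‖a‖ := norm_mul_le _ _
      _ ≤ (‖a‖ * ‖e * y * e - α‖) * ‖a‖ := by gcongr; exact norm_mul_le _ _
      _ = _ := by rw [ha1, one_mul, mul_one]
  have hdecomp : a * (y + z) * a - (a * α * a + β) = (a * y * a - a * (e * y * e) * a)
      + a * (e * y * e - α) * a + (a * z * a - β) := by noncomm_ring
  rw [hdecomp]
  refine (norm_add₃_le).trans_lt ?_
  linarith

/-- To be aperiodic modulo `A`, it suffices that every nonzero hereditary subalgebra contains a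
positive norm-one element multiplying the given element to one that is aperiodic modulo `A`. -/
lemma isAperiodicMod_of_exists_mul {A : NonUnitalStarSubalgebra ℂ B} {w : B}
    (h : ∀ D : NonUnitalStarSubalgebra ℂ B, IsNonzeroHereditary A D →
      ∃ e ∈ D, 0 ≤ e ∧ ‖e‖ = 1 ∧ IsAperiodicMod A (w * e)) : IsAperiodicMod A w := by
  intro ε hε D hD
  obtain ⟨e, he, he0, he1, hwe⟩ := h D hD
  obtain ⟨D', hD', hsub, hfix⟩ := hD.exists_almost_fixed he he0 he1
    (δ := ε / (2 * (‖w‖ + 1))) (by positivity)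
  obtain ⟨a, ha, ha0, ha1, α, hα, hlt⟩ := hwe (ε / 2) (by positivity) D' hD'
  refine ⟨a, hsub ha, ha0, ha1, α, hα, ?_⟩
  have h₁ := norm_conj_sub_conj_le ha1.le w (hfix a ha ha1.le).1
  have h₂ : ε / (2 * (‖w‖ + 1)) * ‖w‖ ≤ ε / 2 := by
    have : ε / (2 * (‖w‖ + 1)) * ‖w‖ = (ε / 2) * (‖w‖ / (‖w‖ + 1)) := by
      field_simp
    rw [this]
    refine mul_le_of_le_one_right (by positivity) ((div_le_one (by positivity)).2 (by linarith))
  have : a * w * a - α = (a * w * a - a * (w * e) * a) + (a * (w * e) * a - α) := by abel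
  rw [this]
  refine (norm_add_le _ _).trans_lt ?_
  linarith

lemma isAperiodicMod_of_mem {A : NonUnitalStarSubalgebra ℂ B} {y : B} (hy : y ∈ A) :
    IsAperiodicMod A y := by
  intro ε hε D hD
  obtain ⟨a, ha, ha0, ha1⟩ := hD.exists_nonneg_norm_eq_one
  have haA : a ∈ A := hD.subset ha
  exact ⟨a, ha, ha0, ha1, a * y * a, mul_mem (mul_mem haA hy) haA, by simpa using hε⟩

/-- If a hereditary subalgebra `D` meets a slice `W` trivially, then its positive elements
annihilate `W ∩ A`. -/
lemma IsNonzeroHereditary.mul_eq_zero_of_disjoint {A D : NonUnitalStarSubalgebra ℂ B}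
    (hD : IsNonzeroHereditary A D) {W : Submodule ℂ B} (hW : IsSlice A W)
    (hdisj : ∀ x ∈ D, x ∈ W → x = 0) {e z : B} (he : e ∈ D) (he0 : 0 ≤ e) (hzW : z ∈ W)
    (hzA : z ∈ A) : e * z = 0 ∧ z * e = 0 := by
  obtain ⟨-, -, hbim, -⟩ := hW
  have hsa : star e = e := (IsSelfAdjoint.of_nonneg he0).star_eq
  have heA : e ∈ A := hD.subset he
  have aux : ∀ p ∈ A, p ∈ W → 0 ≤ p → e * p * e = 0 := by
    intro p hpA hpW hp0
    refine hdisj _ (hD.mem_of_le _ (mul_mem (mul_mem heA hpA) heA) (((‖p‖ : ℝ) : ℂ) • (e * e))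
      (SMulMemClass.smul_mem _ (mul_mem he he)) ?_ ?_) (hbim e heA _ (hbim e heA p hpW).1).2
    · simpa [hsa] using star_left_conjugate_nonneg hp0 e
    · have := CStarAlgebra.star_left_conjugate_le_norm_smul (a := e) (b := p) (.of_nonneg hp0)
      rw [hsa] at this
      simpa [Complex.coe_smul] using this
  have hszA : star z ∈ A := star_mem hzA
  constructor
  · have := aux (z * star z) (mul_mem hzA hszA) (hbim _ hszA z hzW).2 (mul_star_self_nonneg z)
    rw [← CStarRing.mul_star_self_eq_zero_iff, star_mul, hsa]
    simpa only [mul_assoc] using this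
  · have := aux (star z * z) (mul_mem hszA hzA) (hbim _ hszA z hzW).1 (star_mul_self_nonneg z)
    rw [← CStarRing.star_mul_self_eq_zero_iff, star_mul, hsa]
    simpa only [mul_assoc] using this

lemma IsSlice.isAperiodicMod {A : NonUnitalStarSubalgebra ℂ B} {W : Submodule ℂ B}
    (hW : IsSlice A W)
    (h : ∀ w ∈ W, ∀ c ∈ A, (∀ z ∈ (W : Set B) ∩ A, c * z = 0 ∧ z * c = 0) →
      IsAperiodicMod A (w * c)) {w : B} (hw : w ∈ W) : IsAperiodicMod A w := by
  refine isAperiodicMod_of_exists_mul fun D hD => ?_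
  by_cases hdisj : ∀ x ∈ D, x ∈ W → x = 0
  · obtain ⟨e, he, he0, he1⟩ := hD.exists_nonneg_norm_eq_one
    exact ⟨e, he, he0, he1, h w hw e (hD.subset he) fun z hz =>
      hD.mul_eq_zero_of_disjoint hW hdisj he he0 hz.1 hz.2⟩
  · push Not at hdisj
    obtain ⟨x, hxD, hxW, hx0⟩ := hdisj
    obtain ⟨z, hz, hz1⟩ := exists_norm_eq_one (S := D.toSubmodule ⊓ W) ⟨x, ⟨hxD, hxW⟩, hx0⟩
    have hzD : z ∈ D := hz.1
    obtain ⟨-, -, hbim, hinner⟩ := hW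
    refine ⟨star z * z, mul_mem (star_mem hzD) hzD, star_mul_self_nonneg z,
      by rw [CStarRing.norm_star_mul_self, hz1, one_mul], isAperiodicMod_of_mem ?_⟩
    have := (hinner w hw _ (hbim (star z) (hD.subset (star_mem hzD)) z hz.2).1).2
    simpa using this

end

/-- Let `A ⊆ B` be a non-degenerate inclusion of C*-algebras.  If `B` is
densely spanned by a family `𝒮` of slices such that for every `W ∈ 𝒮` the closed span of
`W ⬝ (W ∩ A)^⊥` is an aperiodic `A`-bimodule, then the inclusion `A ⊆ B` is aperiodic. -/
theorem stmt2 {B : Type*} [NonUnitalCStarAlgebra B] [PartialOrder B] [StarOrderedRing B]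
    (A : NonUnitalStarSubalgebra ℂ B) (hAclosed : IsClosed (A : Set B))
    -- non-degeneracy of the inclusion
    (hnondeg : closure (Submodule.span ℂ {x : B | ∃ a ∈ A, ∃ b : B, x = a * b} : Set B)
      = Set.univ)
    (𝒮 : Set (Submodule ℂ B)) (hslice : ∀ W ∈ 𝒮, IsSlice A W)
    -- the linear span of the union of the slices is dense in `B`
    (hdense : closure (Submodule.span ℂ (⋃ W ∈ 𝒮, (W : Set B)) : Set B) = Set.univ)
    -- for every `W ∈ 𝒮`, the closed span of `{w c : w ∈ W, c ∈ (W ∩ A)^⊥}` is an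
    -- aperiodic `A`-bimodule
    (haper : ∀ W ∈ 𝒮, ∀ y ∈ closure (Submodule.span ℂ
        {x : B | ∃ w ∈ W, ∃ c ∈ {a : B | a ∈ A ∧
          ∀ z ∈ (W : Set B) ∩ (A : Set B), a * z = 0 ∧ z * a = 0}, x = w * c} : Set B),
      ∀ ε > (0 : ℝ),
      ∀ D : NonUnitalStarSubalgebra ℂ B, IsClosed (D : Set B) → (D : Set B) ⊆ A →
        (∀ a ∈ A, ∀ d ∈ D, 0 ≤ a → a ≤ d → a ∈ D) →
        (∃ d ∈ D, d ≠ 0) →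
        ∃ a ∈ D, 0 ≤ a ∧ ‖a‖ = 1 ∧ ‖a * y * a‖ < ε) :
    ∀ b : B, ∀ ε > (0 : ℝ),
      ∀ D : NonUnitalStarSubalgebra ℂ B, IsClosed (D : Set B) → (D : Set B) ⊆ A →
        (∀ a ∈ A, ∀ d ∈ D, 0 ≤ a → a ≤ d → a ∈ D) →
        (∃ d ∈ D, d ≠ 0) →
        ∃ a ∈ D, 0 ≤ a ∧ ‖a‖ = 1 ∧ Metric.infDist (a * b * a) (A : Set B) < ε := by
  have hS : ∀ y ∈ (Submodule.span ℂ (⋃ W ∈ 𝒮, (W : Set B)) : Set B), IsAperiodicMod A y := by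
    intro y hy
    induction hy using Submodule.span_induction with
    | mem y hy =>
      obtain ⟨W, hW, hyW⟩ := Set.mem_iUnion₂.1 hy
      refine (hslice W hW).isAperiodicMod (fun w hw c hc hann ε hε D hD => ?_) hyW
      obtain ⟨a, ha, ha0, ha1, hlt⟩ := haper W hW (w * c)
        (subset_closure (Submodule.subset_span ⟨w, hw, c, ⟨hc, hann⟩, rfl⟩)) ε hε D
        hD.isClosed hD.subset hD.mem_of_le hD.exists_ne_zero
      exact ⟨a, ha, ha0, ha1, 0, zero_mem A, by rwa [sub_zero]⟩
    | zero => exact isAperiodicMod_zero A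
    | add x y _ _ hx hy => exact hx.add hy
    | smul c x _ hx => exact hx.smul c
  intro b ε hε D hDc hDA hDh hD0
  obtain ⟨a, ha, ha0, ha1, α, hα, hlt⟩ :=
    isAperiodicMod_of_mem_closure hS (hdense ▸ Set.mem_univ b) ε hε D ⟨hDc, hDA, hDh, hD0⟩
  refine ⟨a, ha, ha0, ha1, (Metric.infDist_le_dist_of_mem hα).trans_lt ?_⟩
  rwa [dist_eq_norm]
end

section
/- Let A ⊆ B be a regular non-degenerate inclusion of C*-algebras with A commutative, and let n ∈ N(A,B) be a normaliser. Let X be the character space of A, let V ⊆ X be the interior of the fixed-point set Fix(n) = {φ ∈ X : φ(n*n) > 0 and φ(n* a n) = φ(a) φ(n*n) for all a ∈ A}, and let C₀(V) := {g ∈ A : φ(g) = 0 for all φ ∈ X \ V}. Let M_n be the closed linear span of {a n a' : a, a' ∈ A}. Then for every m' ∈ M_n and every g ∈ C₀(V), the element m' g commutes with every element of A. -/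
open scoped ComplexOrder

/-- Characters separate the points of a commutative C⋆-algebra, unital or not. -/
theorem eq_zero_of_forall_character_eq_zero {A : Type*} [NonUnitalCommCStarAlgebra A] {y : A}
    (h : ∀ φ : WeakDual.characterSpace ℂ A, φ y = 0) : y = 0 := by
  refine Unitization.inr_injective (R := ℂ) ?_
  refine (gelfandTransform_isometry (Unitization ℂ A)).injective ?_
  ext ψ
  let f : A →L[ℂ] ℂ := (WeakDual.CharacterSpace.toCLM ψ).comp
    ({ toFun := fun a => (a : Unitization ℂ A)
       map_add' := Unitization.inr_add ℂ
       map_smul' := Unitization.inr_smul ℂ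
       cont := Unitization.continuous_inr } : A →L[ℂ] Unitization ℂ A)
  have hf : f y = 0 := by
    by_cases h0 : f = 0
    · simp [h0]
    · refine h ⟨f, h0, fun a b => ?_⟩
      change ψ ((a * b : A) : Unitization ℂ A) = ψ a * ψ b
      rw [Unitization.inr_mul, map_mul]
  have hy : ψ (y : Unitization ℂ A) = 0 := hf
  simpa using hy

/-- Characters separate the points of a closed commutative star subalgebra. -/
theorem NonUnitalStarSubalgebra.eq_zero_of_forall_character_eq_zero {B : Type*}
    [NonUnitalCStarAlgebra B] (A : NonUnitalStarSubalgebra ℂ B) (hAclosed : IsClosed (A : Set B))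
    (hAcomm : ∀ a ∈ A, ∀ a' ∈ A, a * a' = a' * a) {y : A}
    (h : ∀ φ : WeakDual.characterSpace ℂ A, φ y = 0) : y = 0 := by
  let _ : NonUnitalCommCStarAlgebra A :=
    { NonUnitalStarSubalgebra.nonUnitalCStarAlgebra A (h_closed := hAclosed) with
      mul_comm := fun a b => Subtype.ext (hAcomm a a.2 b b.2) }
  exact _root_.eq_zero_of_forall_character_eq_zero h

/-- An element `g` of `A` supported where conjugation by the normaliser `n` fixes characters
makes `n * g` commute with `A`. -/
theorem IsNormalizer.mul_commute {B : Type*} [NonUnitalCStarAlgebra B]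
    {A : NonUnitalStarSubalgebra ℂ B} (hAclosed : IsClosed (A : Set B))
    (hAcomm : ∀ a ∈ A, ∀ a' ∈ A, a * a' = a' * a)
    {n : B} (hn : IsNormalizer A n) (hnn : star n * n ∈ A) {g : A}
    (hg : ∀ φ : WeakDual.characterSpace ℂ A, φ g = 0 ∨
      ∀ a : A, φ ⟨star n * (a : B) * n, hn.1 (a : B) a.2⟩ = φ a * φ ⟨star n * n, hnn⟩)
    (b : A) : (n * (g : B)) * b = b * (n * (g : B)) := by
  let c : A → A := fun a => ⟨star n * (a : B) * n, hn.1 (a : B) a.2⟩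
  let N : A := ⟨star n * n, hnn⟩
  let y : A := star g * (c (star b * b) - c (star b) * b - star b * c b + star b * N * b) * g
  have hy : y = 0 := by
    refine A.eq_zero_of_forall_character_eq_zero hAclosed hAcomm fun φ => ?_
    rcases hg φ with h | h
    · simp only [y, map_mul, h, mul_zero]
    · have hc : ∀ a, φ (c a) = φ a * φ N := h
      simp only [y, map_mul, map_sub, map_add, hc]
      ring
  have hx : (b * n - n * b) * (g : B) = 0 := by
    refine (CStarRing.star_mul_self_eq_zero_iff _).1 ?_
    rw [← ZeroMemClass.coe_zero A, ← hy]
    simp only [y, c, N, star_mul, star_sub, NonUnitalStarSubalgebra.coe_mul,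
      NonUnitalStarSubalgebra.coe_sub, NonUnitalStarSubalgebra.coe_add,
      StarMemClass.coe_star]
    noncomm_ring
  rw [sub_mul, sub_eq_zero] at hx
  rw [mul_assoc, hAcomm g g.2 b b.2, ← mul_assoc, ← hx, mul_assoc]

/-- Let `A ⊆ B` be a regular non-degenerate inclusion with `A`
commutative, `n` a normaliser, `V` the interior of the fixed-point set of `n` in the
character space of `A`, and `M_n` the slice generated by `n`.  Then every `m' g` with
`m' ∈ M_n` and `g ∈ C₀(V)` commutes with every element of `A`. -/
theorem stmt3 {B : Type*} [NonUnitalCStarAlgebra B]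
    (A : NonUnitalStarSubalgebra ℂ B) (hAclosed : IsClosed (A : Set B))
    (hAcomm : ∀ a ∈ A, ∀ a' ∈ A, a * a' = a' * a)
    -- the inclusion is regular
    (hreg : closure (Submodule.span ℂ {m : B | IsNormalizer A m} : Set B) = Set.univ)
    -- the inclusion is non-degenerate
    (hnondeg : closure (Submodule.span ℂ {x : B | ∃ a ∈ A, ∃ b : B, x = a * b} : Set B)
      = Set.univ)
    (n : B) (hn : IsNormalizer A n) (hnn : star n * n ∈ A)
    -- the fixed-point set of `n` in the character space of `A`
    (Fix : Set (WeakDual.characterSpace ℂ A))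
    (hFix : Fix = {φ : WeakDual.characterSpace ℂ A |
      0 < φ ⟨star n * n, hnn⟩ ∧
      ∀ a : A, φ ⟨star n * (a : B) * n, hn.1 (a : B) a.2⟩ = φ a * φ ⟨star n * n, hnn⟩})
    (V : Set (WeakDual.characterSpace ℂ A)) (hV : V = interior Fix)
    -- `C₀(V) = {g ∈ A : φ(g) = 0 for all characters φ ∉ V}`
    (C0V : Set A)
    (hC0V : C0V = {g : A | ∀ φ : WeakDual.characterSpace ℂ A, φ ∉ V → φ g = 0})
    -- the slice generated by `n`
    (Mn : Set B)
    (hMn : Mn = closure (Submodule.span ℂ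
      {x : B | ∃ a ∈ A, ∃ a' ∈ A, x = a * n * a'} : Set B)) :
    ∀ m' ∈ Mn, ∀ g ∈ C0V, ∀ a ∈ A, (m' * (g : B)) * a = a * (m' * (g : B)) := by
  subst hFix hV hC0V hMn
  intro m hm g hg a ha
  have hcomm (g' : A) (hg' : ∀ φ : WeakDual.characterSpace ℂ A, φ g = 0 → φ g' = 0) (b : A) :
      (n * (g' : B)) * b = b * (n * (g' : B)) := by
    refine hn.mul_commute hAclosed hAcomm hnn (fun φ => ?_) b
    by_cases hφ : φ g = 0
    · exact Or.inl (hg' φ hφ)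
    · exact Or.inr (interior_subset (not_imp_comm.1 (hg φ) hφ)).2
  have hclosed : IsClosed {m : B | (m * (g : B)) * a = a * (m * (g : B))} :=
    isClosed_eq (by fun_prop) (by fun_prop)
  refine closure_minimal (fun m hm => ?_) hclosed hm
  change (m * (g : B)) * a = a * (m * (g : B))
  induction hm using Submodule.span_induction with
  | mem x hx =>
    obtain ⟨c, hc, c', hc', rfl⟩ := hx
    have h := hcomm (⟨c', hc'⟩ * g) (fun φ h => by rw [map_mul, h, mul_zero]) ⟨a, ha⟩
    simp only [NonUnitalStarSubalgebra.coe_mul] at h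
    calc c * n * c' * g * a = c * (n * (c' * g) * a) := by simp only [mul_assoc]
      _ = (c * a) * (n * (c' * g)) := by rw [h, mul_assoc]
      _ = a * (c * n * c' * g) := by rw [hAcomm c hc a ha]; simp only [mul_assoc]
  | zero => simp
  | add x y _ _ hx hy => simp only [add_mul, mul_add, hx, hy]
  | smul r x _ hx => simp only [smul_mul_assoc, mul_smul_comm, hx]
end

section
/- Let A be a commutative closed *-subalgebra of a C*-algebra B containing an approximate unit for B, and let W be a slice for the inclusion A ⊆ B. Then for all m, n ∈ W, every character φ of A with φ(m*m) > 0 and φ(n*n) > 0, and every a ∈ A, one has φ(m* a m) · φ(n*n) = φ(n* a n) · φ(m*m). (Equivalently, the partial homeomorphisms α_m and α_n of the character space induced by m and n agree on dom(m) ∩ dom(n).) -/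
open scoped ComplexOrder

/-- Let `A` be a commutative closed *-subalgebra of a C*-algebra `B`
containing an approximate unit for `B` (equivalently, the closed linear span of
`{a b : a ∈ A, b ∈ B}` is `B`), and let `W` be a slice for `A ⊆ B`.  Then for all
`m, n ∈ W`, every character `φ` of `A` with `φ(m* m) > 0` and `φ(n* n) > 0`, and every
`a ∈ A`, one has `φ(m* a m) φ(n* n) = φ(n* a n) φ(m* m)`:  the partial homeomorphisms
induced by `m` and `n` agree on `dom(m) ∩ dom(n)`. -/
theorem stmt5 {B : Type*} [NonUnitalCStarAlgebra B]
    (A : NonUnitalStarSubalgebra ℂ B) (hAclosed : IsClosed (A : Set B))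
    (hAcomm : ∀ a ∈ A, ∀ a' ∈ A, a * a' = a' * a)
    -- the inclusion is non-degenerate
    (hnondeg : closure (Submodule.span ℂ {x : B | ∃ a ∈ A, ∃ b : B, x = a * b} : Set B)
      = Set.univ)
    -- `W` is a slice for the inclusion `A ⊆ B`
    (W : Submodule ℂ B) (hWclosed : IsClosed (W : Set B))
    (hWnorm : ∀ w ∈ W, IsNormalizer A w)
    (hWmod : ∀ a ∈ A, ∀ w ∈ W, a * w ∈ W ∧ w * a ∈ W)
    (hWA : ∀ v ∈ W, ∀ w ∈ W, star v * w ∈ A ∧ v * star w ∈ A) :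
    ∀ m, ∀ hm : m ∈ W, ∀ n, ∀ hn : n ∈ W,
      ∀ φ : WeakDual.characterSpace ℂ A,
        0 < φ ⟨star m * m, (hWA m hm m hm).1⟩ →
        0 < φ ⟨star n * n, (hWA n hn n hn).1⟩ →
        ∀ a : A,
          φ ⟨star m * (a : B) * m, (hWnorm m hm).1 (a : B) a.2⟩
              * φ ⟨star n * n, (hWA n hn n hn).1⟩
            = φ ⟨star n * (a : B) * n, (hWnorm n hn).1 (a : B) a.2⟩
              * φ ⟨star m * m, (hWA m hm m hm).1⟩ := by
  intro m hm n hn φ _ hφn a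
  have hcomm := hAcomm a a.2 _ (A.mul_mem (hWA m hm n hn).2 (hWA n hn n hn).2)
  set P : A := ⟨star n * n, (hWA n hn n hn).1⟩
  set Q : A := ⟨star m * m, (hWA m hm m hm).1⟩
  set X : A := ⟨star m * (a : B) * m, (hWnorm m hm).1 (a : B) a.2⟩
  set Y : A := ⟨star n * (a : B) * n, (hWnorm n hn).1 (a : B) a.2⟩
  have key : P * X * P * P = P * Q * P * Y := by
    apply Subtype.ext
    change star n * n * (star m * (a : B) * m) * (star n * n) * (star n * n)
      = star n * n * (star m * m) * (star n * n) * (star n * (a : B) * n)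
    simpa only [mul_assoc] using congrArg (fun x => star n * n * star m * x * n) hcomm
  have hφ := congrArg φ key
  simp only [map_mul] at hφ
  refine mul_left_cancel₀ (pow_ne_zero 2 hφn.ne') ?_
  linear_combination hφ
end

section
/- Let A₁ ⊆ B₁ and A₂ ⊆ B₂ be regular non-degenerate inclusions of C*-algebras, and let φ : B₁ → B₂ be a *-homomorphism satisfying φ(N(A₁,B₁)) ⊆ N(A₂,B₂), i.e. φ maps every normaliser of A₁ in B₁ to a normaliser of A₂ in B₂. Then φ(A₁) ⊆ A₂. -/
open Filter Topology in
/-- For a non-degenerate inclusion, every bounded approximate unit of the subalgebra is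
a left approximate unit for the ambient algebra. -/
theorem tendsto_approximateUnit_mul_of_nondegenerate {B : Type*} [NonUnitalCStarAlgebra B]
    (A : NonUnitalStarSubalgebra ℂ B)
    (hnd : closure (Submodule.span ℂ {x : B | ∃ a ∈ A, ∃ b : B, x = a * b} : Set B) = Set.univ)
    {l : Filter A} (hl : l.IsApproximateUnit) (hbd : ∀ᶠ e : A in l, ‖(e : B)‖ ≤ 1) (x : B) :
    Tendsto (fun e : A ↦ (e : B) * x) l (𝓝 x) := by
  have key : ∀ y ∈ Submodule.span ℂ {x : B | ∃ a ∈ A, ∃ b : B, x = a * b},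
      Tendsto (fun e : A ↦ (e : B) * y) l (𝓝 y) := by
    intro y hy
    induction hy using Submodule.span_induction with
    | mem y hy =>
      obtain ⟨a, ha, b, rfl⟩ := hy
      have h := ((continuous_subtype_val.tendsto _).comp
        (hl.tendsto_mul_right (⟨a, ha⟩ : A))).mul_const b
      simpa [Function.comp_def, mul_assoc] using h
    | zero => simpa using tendsto_const_nhds
    | add y z _ _ hy hz => simpa [mul_add] using hy.add hz
    | smul c y _ hy => simpa [mul_smul_comm] using hy.const_smul c
  rw [Metric.tendsto_nhds]
  intro ε hε
  have hx : x ∈ closure (Submodule.span ℂ {x : B | ∃ a ∈ A, ∃ b : B, x = a * b} : Set B) :=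
    hnd ▸ Set.mem_univ x
  obtain ⟨y, hy, hxy⟩ := Metric.mem_closure_iff.mp hx (ε / 3) (by positivity)
  filter_upwards [hbd, Metric.tendsto_nhds.mp (key y hy) (ε / 3) (by positivity)] with e he hey
  rw [dist_eq_norm] at hxy hey ⊢
  have h1 : ‖(e : B) * (x - y)‖ ≤ ‖x - y‖ :=
    (norm_mul_le _ _).trans (mul_le_of_le_one_left (norm_nonneg _) he)
  calc ‖(e : B) * x - x‖ = ‖(e : B) * (x - y) + ((e : B) * y - y) - (x - y)‖ := by
        congr 1; rw [mul_sub]; abel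
    _ ≤ ‖(e : B) * (x - y)‖ + ‖(e : B) * y - y‖ + ‖x - y‖ :=
        (norm_sub_le _ _).trans (add_le_add_left (norm_add_le _ _) _)
    _ < ε := by linarith

/-- For a normaliser `n` of a non-degenerate closed subalgebra `A`, one has `n* n ∈ A`. -/
theorem IsNormalizer.star_mul_self_mem {B : Type*} [NonUnitalCStarAlgebra B]
    {A : NonUnitalStarSubalgebra ℂ B} (hA : IsClosed (A : Set B))
    (hnd : closure (Submodule.span ℂ {x : B | ∃ a ∈ A, ∃ b : B, x = a * b} : Set B) = Set.univ)
    {n : B} (hn : IsNormalizer A n) : star n * n ∈ A := by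
  have : IsClosed (A : Set B) := hA
  let : PartialOrder A := CStarAlgebra.spectralOrder A
  have : StarOrderedRing A := CStarAlgebra.spectralOrderedRing A
  have hl := CStarAlgebra.increasingApproximateUnit A
  have hlim := (tendsto_approximateUnit_mul_of_nondegenerate A hnd hl.toIsApproximateUnit
    hl.eventually_norm n).const_mul (star n)
  refine hA.mem_of_tendsto hlim (Filter.Eventually.of_forall fun e ↦ ?_)
  rw [← mul_assoc]
  exact hn.1 e e.2

/-- Every element of a subalgebra is a normaliser of it. -/
theorem isNormalizer_of_mem {B : Type*} [NonUnitalCStarAlgebra B]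
    {A : NonUnitalStarSubalgebra ℂ B} {b : B} (hb : b ∈ A) : IsNormalizer A b :=
  ⟨fun _ ha ↦ mul_mem (mul_mem (star_mem hb) ha) hb,
    fun _ ha ↦ mul_mem (mul_mem hb ha) (star_mem hb)⟩


/-- Let `A₁ ⊆ B₁` and `A₂ ⊆ B₂` be regular non-degenerate inclusions
of C*-algebras and let `φ : B₁ → B₂` be a *-homomorphism mapping normalisers of `A₁` in
`B₁` to normalisers of `A₂` in `B₂`. Then `φ(A₁) ⊆ A₂`. -/
theorem stmt7 {B₁ B₂ : Type*} [NonUnitalCStarAlgebra B₁] [NonUnitalCStarAlgebra B₂]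
    (A₁ : NonUnitalStarSubalgebra ℂ B₁) (hA₁closed : IsClosed (A₁ : Set B₁))
    (A₂ : NonUnitalStarSubalgebra ℂ B₂) (hA₂closed : IsClosed (A₂ : Set B₂))
    -- regularity of both inclusions
    (hreg₁ : closure (Submodule.span ℂ {n : B₁ | IsNormalizer A₁ n} : Set B₁) = Set.univ)
    (hreg₂ : closure (Submodule.span ℂ {n : B₂ | IsNormalizer A₂ n} : Set B₂) = Set.univ)
    -- non-degeneracy of both inclusions
    (hnd₁ : closure (Submodule.span ℂ {x : B₁ | ∃ a ∈ A₁, ∃ b : B₁, x = a * b} : Set B₁)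
      = Set.univ)
    (hnd₂ : closure (Submodule.span ℂ {x : B₂ | ∃ a ∈ A₂, ∃ b : B₂, x = a * b} : Set B₂)
      = Set.univ)
    (φ : B₁ →⋆ₙₐ[ℂ] B₂)
    (hφ : ∀ n : B₁, IsNormalizer A₁ n → IsNormalizer A₂ (φ n)) :
    ∀ a ∈ A₁, φ a ∈ A₂ := by
  intro a ha
  have : IsClosed (A₁ : Set B₁) := hA₁closed
  let : PartialOrder A₁ := CStarAlgebra.spectralOrder A₁
  have : StarOrderedRing A₁ := CStarAlgebra.spectralOrderedRing A₁
  have hspan : (⟨a, ha⟩ : A₁) ∈ Submodule.span ℂ {x : A₁ | 0 ≤ x} := by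
    rw [CStarAlgebra.span_nonneg]
    trivial
  suffices h : ∀ x ∈ Submodule.span ℂ {x : A₁ | 0 ≤ x}, φ (x : B₁) ∈ A₂ from h _ hspan
  intro x hx
  induction hx using Submodule.span_induction with
  | mem x hx =>
    obtain ⟨y, rfl⟩ := CStarAlgebra.nonneg_iff_eq_star_mul_self.mp (Set.mem_ofPred.mp hx)
    have h := (hφ y (isNormalizer_of_mem y.2)).star_mul_self_mem hA₂closed hnd₂
    rwa [← map_star, ← map_mul] at h
  | zero => simp
  | add x y _ _ hx hy => simpa using add_mem hx hy
  | smul c x _ hx => simpa using SMulMemClass.smul_mem c hx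
end

section
/- Let A ⊆ B be a regular masa inclusion of C*-algebras with A commutative with character space X, let n ∈ N(A,B) be a normaliser, and let M_n be the closed linear span of {a n a' : a, a' ∈ A}. Let V ⊆ X be interior of the fixed-point set Fix(n) = {φ ∈ X : φ(n*n) > 0 and φ(n* a n) = φ(a) φ(n*n) for all a ∈ A}. Then M_n ∩ A = C₀(V), where C₀(V) := {g ∈ A : φ(g) = 0 for all φ ∈ X \ V}. -/
open scoped ComplexOrder

namespace WeakDual.CharacterSpace

/-- An element of a closed ideal of a unital commutative C⋆-algebra is detected by the
characters annihilating the ideal. -/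
theorem mem_ideal_of_forall_apply_eq_zero {U : Type*} [CommCStarAlgebra U] (I : Ideal U)
    (hI : IsClosed (I : Set U)) (f : U)
    (hf : ∀ φ : characterSpace ℂ U, (∀ i ∈ I, φ i = 0) → φ f = 0) : f ∈ I := by
  let e := gelfandStarTransform U
  let K : Ideal C(characterSpace ℂ U, ℂ) := I.comap (e.symm : C(characterSpace ℂ U, ℂ) →⋆ₐ[ℂ] U)
  have hcont : Continuous e.symm := (NonUnitalStarAlgHom.isometry e.symm e.symm.injective).continuous
  have hK : IsClosed (K : Set C(characterSpace ℂ U, ℂ)) := hI.preimage hcont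
  have hmem : e f ∈ K := by
    rw [← ContinuousMap.idealOfSet_ofIdeal_isClosed hK, ContinuousMap.mem_idealOfSet]
    intro φ hφ
    rw [Set.mem_compl_iff, ContinuousMap.notMem_setOfIdeal] at hφ
    refine hf φ fun i hi => hφ (f := e i) ?_
    change e.symm (e i) ∈ I
    simpa using hi
  have hmem' : e.symm (e f) ∈ I := hmem
  simpa using hmem'

/-- An element of a closed ideal of a commutative C⋆-algebra is detected by the characters
annihilating the ideal. -/
theorem mem_submodule_of_forall_apply_eq_zero {C : Type*} [NonUnitalCommCStarAlgebra C]
    (J : Submodule ℂ C) (hJ : IsClosed (J : Set C)) (hmul : ∀ a, ∀ j ∈ J, a * j ∈ J) (f : C)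
    (hf : ∀ φ : characterSpace ℂ C, (∀ j ∈ J, φ j = 0) → φ f = 0) : f ∈ J := by
  let I : Ideal (Unitization ℂ C) :=
    { carrier := ((↑) : C → Unitization ℂ C) '' J
      add_mem' := by
        rintro _ _ ⟨x, hx, rfl⟩ ⟨y, hy, rfl⟩
        exact ⟨x + y, J.add_mem hx hy, Unitization.inr_add ℂ x y⟩
      zero_mem' := ⟨0, J.zero_mem, Unitization.inr_zero ℂ⟩
      smul_mem' := by
        rintro u _ ⟨x, hx, rfl⟩
        induction u with
        | inl_add_inr r a =>
          refine ⟨r • x + a * x, J.add_mem (J.smul_mem r hx) (hmul a x hx), ?_⟩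
          rw [smul_eq_mul, add_mul, Unitization.inl_mul_inr, ← Unitization.inr_mul,
            Unitization.inr_add] }
  have hI : IsClosed (I : Set (Unitization ℂ C)) :=
    (Unitization.isometry_inr (𝕜 := ℂ) (A := C)).isClosedEmbedding.isClosedMap _ hJ
  have key : (f : Unitization ℂ C) ∈ I := by
    refine mem_ideal_of_forall_apply_eq_zero I hI _ fun φ hφ => ?_
    let ψ : WeakDual ℂ C :=
      ((toCLM φ).comp
        ⟨(Unitization.inrNonUnitalAlgHom ℂ C : C →ₗ[ℂ] Unitization ℂ C),
          Unitization.continuous_inr⟩ : C →L[ℂ] ℂ)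
    have hψ (x : C) : ψ x = φ (x : Unitization ℂ C) := rfl
    by_cases h0 : ψ = 0
    · rw [← hψ, h0]; rfl
    · let χ : characterSpace ℂ C := ⟨ψ, h0, fun x y => by simp [hψ]⟩
      exact hf χ fun j hj => hφ j ⟨j, hj, rfl⟩
  obtain ⟨x, hx, hxf⟩ := key
  rwa [← Unitization.inr_injective hxf]

/-- Characters of a C⋆-algebra preserve the star operation. -/
theorem apply_star {C : Type*} [NonUnitalCStarAlgebra C] (φ : characterSpace ℂ C) (a : C) :
    φ (star a) = star (φ a) := by
  let Φ : Unitization ℂ C →ₐ[ℂ] ℂ := Unitization.lift (toNonUnitalAlgHom φ)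
  have hΦ (x : C) : Φ x = φ x := by simp [Φ]
  have : StarHomClass (Unitization ℂ C →ₐ[ℂ] ℂ) (Unitization ℂ C) ℂ :=
    AlgHomClass.instStarHomClass
  rw [← hΦ, ← hΦ, Unitization.inr_star, map_star]

end WeakDual.CharacterSpace

/-- A maximal abelian subalgebra contains the square root of each of its positive elements. -/
theorem exists_isSelfAdjoint_mul_self_eq_s9 {B : Type*} [NonUnitalCStarAlgebra B]
    (A : NonUnitalStarSubalgebra ℂ B)
    (hAcomm : ∀ a ∈ A, ∀ a' ∈ A, a * a' = a' * a)
    (hAmasa : ∀ b : B, (∀ a ∈ A, b * a = a * b) → b ∈ A)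
    (n : B) (hnn : star n * n ∈ A) :
    ∃ s ∈ A, IsSelfAdjoint s ∧ s * s = star n * n := by
  let := CStarAlgebra.spectralOrder B
  have := CStarAlgebra.spectralOrderedRing B
  refine ⟨CFC.sqrt (star n * n), hAmasa _ fun a ha => ?_, ?_, ?_⟩
  · exact (Commute.cfcₙ_nnreal (show Commute (star n * n) a from hAcomm _ hnn a ha) _).eq
  · exact (CFC.sqrt_nonneg _).isSelfAdjoint
  · exact CFC.sqrt_mul_sqrt_self _ (star_mul_self_nonneg n)

/-- A closed commutative star subalgebra of a C⋆-algebra is a commutative C⋆-algebra. -/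
noncomputable abbrev NonUnitalStarSubalgebra.commCStarAlgebraOfClosed {B : Type*}
    [NonUnitalCStarAlgebra B] (A : NonUnitalStarSubalgebra ℂ B) (hAclosed : IsClosed (A : Set B))
    (hAcomm : ∀ a ∈ A, ∀ a' ∈ A, a * a' = a' * a) : NonUnitalCommCStarAlgebra A :=
  { NonUnitalStarSubalgebra.nonUnitalCStarAlgebra A (h_closed := hAclosed) with
    mul_comm := fun a b => Subtype.ext (hAcomm a a.2 b b.2) }

section Slice

open WeakDual

variable {B : Type*} [NonUnitalCStarAlgebra B]

/-- The slice generated by `n` over `A`: the closed linear span of `A n A`. -/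
def slice (A : NonUnitalStarSubalgebra ℂ B) (n : B) : Submodule ℂ B :=
  (Submodule.span ℂ {x : B | ∃ a ∈ A, ∃ a' ∈ A, x = a * n * a'}).topologicalClosure

theorem mul_mul_mem_slice {A : NonUnitalStarSubalgebra ℂ B} (n : B) {a a' : B} (ha : a ∈ A)
    (ha' : a' ∈ A) : a * n * a' ∈ slice A n :=
  Submodule.le_topologicalClosure _ (Submodule.subset_span ⟨a, ha, a', ha', rfl⟩)

theorem slice_le {A : NonUnitalStarSubalgebra ℂ B} {n : B} {K : Submodule ℂ B}
    (hK : IsClosed (K : Set B)) (h : ∀ a ∈ A, ∀ a' ∈ A, a * n * a' ∈ K) : slice A n ≤ K := by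
  refine Submodule.topologicalClosure_minimal _ (Submodule.span_le.mpr ?_) hK
  rintro _ ⟨a, ha, a', ha', rfl⟩
  exact h a ha a' ha'

theorem mul_mem_slice {A : NonUnitalStarSubalgebra ℂ B} {n a x : B} (ha : a ∈ A)
    (hx : x ∈ slice A n) : a * x ∈ slice A n := by
  have hle : slice A n ≤ (slice A n).comap (LinearMap.mulLeft ℂ a) := by
    refine slice_le ?_ fun b hb c hc => ?_
    · exact (Submodule.isClosed_topologicalClosure _).preimage (continuous_const_mul a)
    · change a * (b * n * c) ∈ slice A n
      rw [← mul_assoc, ← mul_assoc]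
      exact mul_mul_mem_slice n (mul_mem ha hb) hc
  exact hle hx

/-- Elements of the slice generated by a normaliser `n` intertwine `a` and `n* a n`. -/
theorem mul_mul_star_mul_self_of_mem_slice {A : NonUnitalStarSubalgebra ℂ B}
    (hAcomm : ∀ a ∈ A, ∀ a' ∈ A, a * a' = a' * a) {n : B} (hn : IsNormalizer A n)
    {a x : B} (ha : a ∈ A) (hx : x ∈ slice A n) :
    a * x * (star n * n) = x * (star n * a * n) := by
  have hle : slice A n ≤ LinearMap.eqLocus
      (LinearMap.mulRight ℂ (star n * n) ∘ₗ LinearMap.mulLeft ℂ a)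
      (LinearMap.mulRight ℂ (star n * a * n)) := by
    refine slice_le ?_ fun b hb c hc => ?_
    · exact isClosed_eq (f := fun x : B => a * x * (star n * n))
        (g := fun x : B => x * (star n * a * n)) (by fun_prop) (by fun_prop)
    · change a * (b * n * c) * (star n * n) = b * n * c * (star n * a * n)
      calc a * (b * n * c) * (star n * n) = a * b * (n * c * star n) * n := by
            simp only [mul_assoc]
        _ = b * (a * (n * c * star n)) * n := by rw [hAcomm a ha b hb]; simp only [mul_assoc]
        _ = b * ((n * c * star n) * a) * n := by rw [hAcomm a ha _ (hn.2 c hc)]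
        _ = b * n * c * (star n * a * n) := by simp only [mul_assoc]
  exact hle hx

/-- A character annihilating `n* A n` annihilates `x* x` for every `x` in the slice of `n`. -/
theorem apply_star_mul_self_eq_zero_of_mem_slice {A : NonUnitalStarSubalgebra ℂ B}
    (hAclosed : IsClosed (A : Set B)) {n : B} (hn : IsNormalizer A n) (φ : characterSpace ℂ A)
    (hφ : ∀ a : A, φ ⟨star n * (a : B) * n, hn.1 (a : B) a.2⟩ = 0) {x : A}
    (hx : (x : B) ∈ slice A n) : φ (star x * x) = 0 := by
  let _ : NonUnitalCStarAlgebra A :=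
    NonUnitalStarSubalgebra.nonUnitalCStarAlgebra A (h_closed := hAclosed)
  let L : Submodule ℂ B := (LinearMap.ker (CharacterSpace.toCLM φ : A →ₗ[ℂ] ℂ)).map
    (NonUnitalStarSubalgebraClass.subtype A : A →ₗ[ℂ] B)
  have hL : IsClosed (L : Set B) := by
    refine hAclosed.isClosedEmbedding_subtypeVal.isClosedMap _ ?_
    exact (isClosed_singleton (x := (0 : ℂ))).preimage (map_continuous φ)
  have mem_L (z : A) : (z : B) ∈ L ↔ φ z = 0 := by
    constructor
    · rintro ⟨w, hw, hwz⟩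
      rwa [← show w = z from Subtype.ext hwz]
    · exact fun h => ⟨z, h, rfl⟩
  have star_L {z : B} (hz : z ∈ L) : star z ∈ L := by
    obtain ⟨w, hw, rfl⟩ := hz
    refine (mem_L (star w)).mpr ?_
    rw [CharacterSpace.apply_star, show φ w = 0 from hw, star_zero]
  have comapL (y : B) : IsClosed ((L.comap (LinearMap.mulLeft ℂ y) : Submodule ℂ B) : Set B) :=
    hL.preimage (continuous_const_mul y)
  have gen_mul {b c y : B} (hb : b ∈ A) (hc : c ∈ A) (hy : y ∈ slice A n) :
      star (b * n * c) * y ∈ L := by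
    refine slice_le (comapL (star (b * n * c))) (fun b' hb' c' hc' => ?_) hy
    have hbb : star b * b' ∈ A := mul_mem (star_mem hb) hb'
    have := (mem_L ((⟨star c, star_mem hc⟩ : A) *
      ⟨star n * (star b * b') * n, hn.1 _ hbb⟩ * ⟨c', hc'⟩)).mpr (by
        rw [map_mul, map_mul, hφ ⟨_, hbb⟩]; simp)
    change star (b * n * c) * (b' * n * c') ∈ L
    convert this using 1
    simp [mul_assoc]
  have := slice_le (comapL (star (x : B))) (fun b hb c hc => by
    have := star_L (gen_mul hb hc hx)
    rwa [star_mul, star_star] at this) hx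
  exact (mem_L (star x * x)).mp this

/-- An element of the slice lying in `A` only lives on characters fixed by `n`. -/
theorem fixed_of_mem_slice {A : NonUnitalStarSubalgebra ℂ B}
    (hAclosed : IsClosed (A : Set B)) (hAcomm : ∀ a ∈ A, ∀ a' ∈ A, a * a' = a' * a)
    {n : B} (hn : IsNormalizer A n) (hnn : star n * n ∈ A) (φ : characterSpace ℂ A)
    {x : A} (hx : (x : B) ∈ slice A n) (hφx : φ x ≠ 0) :
    φ ⟨star n * n, hnn⟩ ≠ 0 ∧
      ∀ a : A, φ ⟨star n * (a : B) * n, hn.1 (a : B) a.2⟩ = φ a * φ ⟨star n * n, hnn⟩ := by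
  let _ : NonUnitalCStarAlgebra A :=
    NonUnitalStarSubalgebra.nonUnitalCStarAlgebra A (h_closed := hAclosed)
  have hfix (a : A) :
      φ ⟨star n * (a : B) * n, hn.1 (a : B) a.2⟩ = φ a * φ ⟨star n * n, hnn⟩ := by
    have h : a * x * ⟨star n * n, hnn⟩ = x * ⟨star n * (a : B) * n, hn.1 (a : B) a.2⟩ :=
      Subtype.ext (mul_mul_star_mul_self_of_mem_slice hAcomm hn a.2 hx)
    have h' := congrArg φ h
    simp only [map_mul] at h'
    apply mul_left_cancel₀ hφx
    rw [← h']; ring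
  refine ⟨fun h0 => ?_, hfix⟩
  have := apply_star_mul_self_eq_zero_of_mem_slice hAclosed hn φ
    (fun a => by rw [hfix, h0, mul_zero]) hx
  rw [map_mul, CharacterSpace.apply_star] at this
  simp [hφx] at this

/-- If `g ∈ A` vanishes off the characters fixed by `n`, then `n g ∈ A`. -/
theorem mul_mem_of_apply_eq_zero_or_fixed {A : NonUnitalStarSubalgebra ℂ B}
    (hAclosed : IsClosed (A : Set B)) (hAcomm : ∀ a ∈ A, ∀ a' ∈ A, a * a' = a' * a)
    (hAmasa : ∀ b : B, (∀ a ∈ A, b * a = a * b) → b ∈ A)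
    {n : B} (hn : IsNormalizer A n) (hnn : star n * n ∈ A) (g : A)
    (hg : ∀ φ : characterSpace ℂ A, φ g = 0 ∨
      ∀ a : A, φ ⟨star n * (a : B) * n, hn.1 (a : B) a.2⟩ = φ a * φ ⟨star n * n, hnn⟩) :
    n * (g : B) ∈ A := by
  let _ : NonUnitalCommCStarAlgebra A := A.commCStarAlgebraOfClosed hAclosed hAcomm
  let N (a : A) : A := ⟨star n * (a : B) * n, hn.1 (a : B) a.2⟩
  let P : A := ⟨star n * n, hnn⟩
  refine hAmasa _ fun b hb => ?_
  let a : A := ⟨b, hb⟩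
  let D : A := star a * star g * P * g * a - star a * star g * N a * g
    - star g * N (star a) * g * a + star g * N (star a * a) * g
  have hD : D = 0 := by
    refine (Submodule.mem_bot ℂ).mp (CharacterSpace.mem_submodule_of_forall_apply_eq_zero
      (⊥ : Submodule ℂ A) isClosed_singleton (by simp) D fun φ _ => ?_)
    rcases hg φ with h | h
    · simp [D, map_add, map_sub, map_mul, h]
    · have hN (a : A) : φ (N a) = φ a * φ P := h a
      simp only [D, map_add, map_sub, map_mul, hN]
      ring
  have hd : star (n * g * b - b * (n * g)) * (n * g * b - b * (n * g)) = (D : B) := by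
    simp [D, N, P, a, mul_sub, sub_mul, mul_assoc]
    abel
  rw [hD] at hd
  exact sub_eq_zero.mp (CStarRing.star_mul_self_eq_zero_iff _ |>.mp hd)

end Slice

/-- Let `A ⊆ B` be a regular masa inclusion, `n` a normaliser,
`M_n` the slice generated by `n`, and `V` the interior of the fixed-point set of `n`
in the character space of `A`.  Then `M_n ∩ A = C₀(V)`. -/
theorem stmt9 {B : Type*} [NonUnitalCStarAlgebra B]
    (A : NonUnitalStarSubalgebra ℂ B) (hAclosed : IsClosed (A : Set B))
    (hAcomm : ∀ a ∈ A, ∀ a' ∈ A, a * a' = a' * a)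
    (hAmasa : ∀ b : B, (∀ a ∈ A, b * a = a * b) → b ∈ A)
    (hreg : closure (Submodule.span ℂ {m : B | IsNormalizer A m} : Set B) = Set.univ)
    (n : B) (hn : IsNormalizer A n) (hnn : star n * n ∈ A)
    (Mn : Set B)
    (hMn : Mn = closure (Submodule.span ℂ
      {x : B | ∃ a ∈ A, ∃ a' ∈ A, x = a * n * a'} : Set B))
    (Fix : Set (WeakDual.characterSpace ℂ A))
    (hFix : Fix = {φ : WeakDual.characterSpace ℂ A |
      0 < φ ⟨star n * n, hnn⟩ ∧
      ∀ a : A, φ ⟨star n * (a : B) * n, hn.1 (a : B) a.2⟩ = φ a * φ ⟨star n * n, hnn⟩})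
    (V : Set (WeakDual.characterSpace ℂ A)) (hV : V = interior Fix) :
    Mn ∩ (A : Set B)
      = {x : B | ∃ h : x ∈ A, ∀ φ : WeakDual.characterSpace ℂ A, φ ∉ V → φ ⟨x, h⟩ = 0} := by
  let _ : NonUnitalCommCStarAlgebra A := A.commCStarAlgebraOfClosed hAclosed hAcomm
  have hMn' : Mn = (slice A n : Set B) := hMn
  have hVFix : V ⊆ Fix := hV ▸ interior_subset
  ext x
  constructor
  · rintro ⟨hxM, hxA⟩
    rw [hMn'] at hxM
    refine ⟨hxA, fun φ hφ => ?_⟩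
    by_contra hne
    refine hφ ?_
    rw [hV, mem_interior]
    refine ⟨{ψ | ψ ⟨x, hxA⟩ ≠ 0}, fun ψ hψ => ?_, ?_, hne⟩
    · have hfix := fixed_of_mem_slice hAclosed hAcomm hn hnn ψ (x := ⟨x, hxA⟩) hxM hψ
      rw [hFix]
      refine ⟨lt_of_le_of_ne ?_ hfix.1.symm, hfix.2⟩
      obtain ⟨s, hsA, hs, hss⟩ := exists_isSelfAdjoint_mul_self_eq_s9 A hAcomm hAmasa n hnn
      have hPs : (⟨star n * n, hnn⟩ : A) = star ⟨s, hsA⟩ * ⟨s, hsA⟩ :=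
        Subtype.ext (hss.symm.trans (congrArg (· * s) hs.star_eq.symm))
      rw [hPs, map_mul, WeakDual.CharacterSpace.apply_star]
      exact star_mul_self_nonneg _
    · exact isOpen_ne.preimage
        ((WeakDual.eval_continuous (⟨x, hxA⟩ : A)).comp continuous_subtype_val)
  · rintro ⟨hxA, hx⟩
    refine ⟨?_, hxA⟩
    rw [hMn']
    let f : A := ⟨x, hxA⟩
    let P : A := ⟨star n * n, hnn⟩
    have hnf : n * (f : B) ∈ A := by
      refine mul_mem_of_apply_eq_zero_or_fixed hAclosed hAcomm hAmasa hn hnn f fun φ => ?_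
      by_cases hφ : φ ∈ V
      · have := hVFix hφ
        rw [hFix] at this
        exact Or.inr this.2
      · exact Or.inl (hx φ hφ)
    have hmem : ((star f * P * f : A) : B) ∈ slice A n := by
      have := mul_mul_mem_slice n (star_mem hnf) f.2
      simpa [f, P, mul_assoc] using this
    let J : Submodule ℂ A :=
      (slice A n).comap (NonUnitalStarSubalgebraClass.subtype A : A →ₗ[ℂ] B)
    refine WeakDual.CharacterSpace.mem_submodule_of_forall_apply_eq_zero J
      ((Submodule.isClosed_topologicalClosure _).preimage continuous_subtype_val)
      (fun a j hj => mul_mem_slice a.2 hj) f fun φ hφ => ?_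
    by_cases hφV : φ ∈ V
    · have hfix := hVFix hφV
      rw [hFix] at hfix
      have h0 : φ (star f * P * f) = 0 := hφ _ hmem
      rw [map_mul, map_mul, WeakDual.CharacterSpace.apply_star] at h0
      simpa [P, hfix.1.ne'] using h0
    · exact hx φ hφV
end

section
/- Let A ⊆ B be a regular masa inclusion of C*-algebras with A commutative with character space X, let n ∈ N(A,B) be a normaliser, and let M_n be the closed linear span of {a n a' : a, a' ∈ A}. Let V ⊆ X be the interior of the fixed-point set Fix(n) = {φ ∈ X : φ(n*n) > 0 and φ(n* a n) = φ(a) φ(n*n) for all a ∈ A}, let W := X \ closure(V), and let C₀(W) := {g ∈ A : φ(g) = 0 for all φ ∈ X \ W}. Then the closed linear span of {m g : m ∈ M_n, g ∈ C₀(W)} has trivial intersection with A: its intersection with A is {0}. -/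
open scoped ComplexOrder

section Gelfand

open WeakDual

variable {R : Type*} [NonUnitalCommCStarAlgebra R]

/-- The characters of a commutative C⋆-algebra, unital or not, preserve the involution. -/
lemma characterSpace_map_star (φ : characterSpace ℂ R) (a : R) :
    φ (star a) = star (φ a) := by
  have h := (AlgHomClass.instStarHomClass
    (F := Unitization ℂ R →ₐ[ℂ] ℂ)).map_star
    (Unitization.lift (CharacterSpace.toNonUnitalAlgHom φ)) (a : Unitization ℂ R)
  rw [← Unitization.inr_star] at h
  simpa using h

/-- The characters of a commutative C⋆-algebra, unital or not, separate its points. -/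
lemma eq_zero_of_forall_characterSpace (a : R) (ha : ∀ φ : characterSpace ℂ R, φ a = 0) :
    a = 0 := by
  apply Unitization.inr_injective (R := ℂ)
  rw [Unitization.inr_zero]
  apply (gelfandTransform_isometry (Unitization ℂ R)).injective
  rw [map_zero]
  ext ψ
  let φ : WeakDual ℂ R := ((CharacterSpace.toCLM ψ).comp
    ⟨(Unitization.inrNonUnitalAlgHom ℂ R : R →ₗ[ℂ] Unitization ℂ R),
      (Unitization.isometry_inr (𝕜 := ℂ) (A := R)).continuous⟩ : R →L[ℂ] ℂ)
  have hφ (x : R) : φ x = ψ (x : Unitization ℂ R) := rfl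
  change ψ (a : Unitization ℂ R) = 0
  rw [← hφ]
  by_cases h0 : φ = 0
  · rw [h0]; rfl
  · exact ha ⟨φ, h0, fun x y ↦ by simp [hφ]⟩

end Gelfand

section ClosedSpan

variable {B : Type*} [NonUnitalCStarAlgebra B]

/-- Induction principle for the closed linear span of a set. -/
lemma closure_span_induction {S : Set B} {p : B → Prop} (hcl : IsClosed {x | p x})
    (mem : ∀ x ∈ S, p x) (zero : p 0) (add : ∀ x y, p x → p y → p (x + y))
    (smul : ∀ (c : ℂ) x, p x → p (c • x)) {x : B}
    (hx : x ∈ closure (Submodule.span ℂ S : Set B)) : p x :=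
  closure_minimal (t := {x | p x})
    (fun _ hy ↦ Submodule.span_induction (p := fun z _ ↦ p z) mem zero
      (fun x y _ _ ↦ add x y) (fun c x _ ↦ smul c x) hy) hcl hx

end ClosedSpan

section Normalizer

variable {B : Type*} [NonUnitalCStarAlgebra B] {A : NonUnitalStarSubalgebra ℂ B} {n : B}

/-- The square root of a positive element of a masa lies in the masa. -/
lemma exists_selfAdjoint_mul_self (hAcomm : ∀ a ∈ A, ∀ a' ∈ A, a * a' = a' * a)
    (hAmasa : ∀ b : B, (∀ a ∈ A, b * a = a * b) → b ∈ A) {x : B} (hx : star x * x ∈ A) :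
    ∃ c ∈ A, star c = c ∧ c * c = star x * x := by
  let _ : PartialOrder B := CStarAlgebra.spectralOrder B
  have _ : StarOrderedRing B := CStarAlgebra.spectralOrderedRing B
  refine ⟨CFC.sqrt (star x * x), hAmasa _ fun a ha ↦ ?_, ?_,
    CFC.sqrt_mul_sqrt_self _ (star_mul_self_nonneg x)⟩
  · exact Commute.cfcₙ_nnreal (hAcomm _ hx a ha) _
  · exact (CFC.sqrt_nonneg _).isSelfAdjoint

/-- If `n` normalises `A` and `n* n ∈ A`, then `n n*` commutes with every element of `A`. -/
lemma IsNormalizer.mul_star_commute (hAcomm : ∀ a ∈ A, ∀ a' ∈ A, a * a' = a' * a)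
    (hn : IsNormalizer A n) (hnn : star n * n ∈ A) {a : B} (ha : a ∈ A) :
    n * star n * a = a * (n * star n) := by
  let _ : PartialOrder B := CStarAlgebra.spectralOrder B
  have _ : StarOrderedRing B := CStarAlgebra.spectralOrderedRing B
  have h : (n * star n) * (n * star n) ∈ A := by
    simpa only [mul_assoc] using hn.2 _ hnn
  rw [← CFC.sqrt_mul_self (n * star n) (mul_star_self_nonneg n)]
  exact Commute.cfcₙ_nnreal (hAcomm _ h a ha) _

/-- The map `a ↦ n* a n` is multiplicative up to the factor `n* n`. -/
lemma IsNormalizer.conj_mul_conj (hAcomm : ∀ a ∈ A, ∀ a' ∈ A, a * a' = a' * a)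
    (hn : IsNormalizer A n) (hnn : star n * n ∈ A) {a b : B} (hb : b ∈ A) :
    (star n * a * n) * (star n * b * n) = (star n * (a * b) * n) * (star n * n) := by
  have h := hn.mul_star_commute hAcomm hnn hb
  calc (star n * a * n) * (star n * b * n) = star n * a * (n * star n * b) * n := by
        simp only [mul_assoc]
    _ = _ := by rw [h]; simp only [mul_assoc]

/-- The generators of the slice `M_n`. -/
abbrev sliceGenerators (A : NonUnitalStarSubalgebra ℂ B) (n : B) : Set B :=
  {x : B | ∃ a ∈ A, ∃ a' ∈ A, x = a * n * a'}

/-- Elements of the slice intertwine `b ∈ A` with `n* b n`. -/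
lemma IsNormalizer.slice_intertwine (hAcomm : ∀ a ∈ A, ∀ a' ∈ A, a * a' = a' * a)
    (hn : IsNormalizer A n) (hnn : star n * n ∈ A) {b x y : B} (hb : b ∈ A)
    (hx : x ∈ closure (Submodule.span ℂ (sliceGenerators A n) : Set B))
    (hy : y ∈ closure (Submodule.span ℂ (sliceGenerators A n) : Set B)) :
    star x * b * y * (star n * n) = star x * y * (star n * b * n) := by
  refine closure_span_induction
      (p := fun y ↦ star x * b * y * (star n * n) = star x * y * (star n * b * n))
      (isClosed_eq (by fun_prop) (by fun_prop)) ?_ (by simp)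
    (fun y y' h h' ↦ by simp only [mul_add, add_mul, h, h'])
    (fun c y h ↦ by simp only [mul_smul_comm, smul_mul_assoc, h]) hy
  rintro _ ⟨c, hc, c', hc', rfl⟩
  refine closure_span_induction
      (p := fun x ↦ star x * b * (c * n * c') * (star n * n) =
        star x * (c * n * c') * (star n * b * n))
      (isClosed_eq (by fun_prop) (by fun_prop)) ?_ (by simp)
    (fun x x' h h' ↦ by simp only [star_add, add_mul, h, h'])
    (fun r x h ↦ by simp only [star_smul, smul_mul_assoc, h]) hx
  rintro _ ⟨a, ha, a', ha', rfl⟩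
  have e1 := hn.conj_mul_conj hAcomm hnn (a := star a * c) hb
  have e2 := hAcomm c' hc' _ hnn
  have e3 := hAcomm c' hc' _ (hn.1 b hb)
  have e4 := hAcomm b hb c hc
  calc star (a * n * a') * b * (c * n * c') * (star n * n)
      = star a' * (star n * star a * (b * c) * n * (c' * (star n * n))) := by
        simp only [star_mul, mul_assoc]
    _ = star a' * ((star n * (star a * c * b) * n) * (star n * n)) * c' := by
        rw [e2, e4]; simp only [mul_assoc]
    _ = star a' * (star n * (star a * c) * n) * ((star n * b * n) * c') := by
        rw [← e1]; simp only [mul_assoc]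
    _ = _ := by rw [← e3]; simp only [star_mul, mul_assoc]

/-- A character of `A` which kills every `n* b n` kills every element `d* d` of `A` with `d`
in the slice of `n`. -/
lemma IsNormalizer.character_slice_eq_zero (hn : IsNormalizer A n)
    (φ : WeakDual.characterSpace ℂ A)
    (hφ : ∀ b : A, φ ⟨star n * (b : B) * n, hn.1 b b.2⟩ = 0) {d : A}
    (hd : (d : B) ∈ closure (Submodule.span ℂ (sliceGenerators A n) : Set B)) :
    φ (star d * d) = 0 := by
  obtain ⟨f, hf, -⟩ := exists_extension_norm_eq (𝕜 := ℂ) A.toSubmodule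
    (WeakDual.CharacterSpace.toCLM φ)
  replace hf (a : A) : f (a : B) = φ a := hf a
  have key : ∀ x ∈ closure (Submodule.span ℂ (sliceGenerators A n) : Set B),
      ∀ y ∈ closure (Submodule.span ℂ (sliceGenerators A n) : Set B), f (star x * y) = 0 := by
    intro x hx y hy
    refine closure_span_induction
      (p := fun y ↦ f (star x * y) = 0)
      (isClosed_eq (by fun_prop) (by fun_prop)) ?_ (by simp)
      (fun y y' h h' ↦ by simp only [mul_add, map_add, h, h', add_zero])
      (fun c y h ↦ by simp only [mul_smul_comm, map_smul, h, smul_zero]) hy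
    rintro _ ⟨c, hc, c', hc', rfl⟩
    refine closure_span_induction
      (p := fun x ↦ f (star x * (c * n * c')) = 0)
      (isClosed_eq (by fun_prop) (by fun_prop)) ?_ (by simp)
      (fun x x' h h' ↦ by simp only [star_add, add_mul, map_add, h, h', add_zero])
      (fun r x h ↦ by simp only [star_smul, smul_mul_assoc, map_smul, h, smul_zero]) hx
    rintro _ ⟨a, ha, a', ha', rfl⟩
    let u : A := star ⟨a, ha⟩ * ⟨c, hc⟩
    have h : star (a * n * a') * (c * n * c') =
        ((star ⟨a', ha'⟩ * ⟨star n * (u : B) * n, hn.1 u u.2⟩ * ⟨c', hc'⟩ : A) : B) := by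
      simp [u, mul_assoc]
    rw [h, hf, map_mul, map_mul, hφ, mul_zero, zero_mul]
  rw [← hf]
  exact key d hd d hd

end Normalizer

/-- Let `A ⊆ B` be a regular masa inclusion, `n` a normaliser, `M_n`
the slice generated by `n`, `V` the interior of the fixed-point set of `n` in the
character space `X` of `A`, and `W = X \ closure V`.  Then the closed linear span of
`{m g : m ∈ M_n, g ∈ C₀(W)}` intersects `A` in `{0}`. -/
theorem stmt10 {B : Type*} [NonUnitalCStarAlgebra B]
    (A : NonUnitalStarSubalgebra ℂ B) (hAclosed : IsClosed (A : Set B))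
    (hAcomm : ∀ a ∈ A, ∀ a' ∈ A, a * a' = a' * a)
    (hAmasa : ∀ b : B, (∀ a ∈ A, b * a = a * b) → b ∈ A)
    (hreg : closure (Submodule.span ℂ {m : B | IsNormalizer A m} : Set B) = Set.univ)
    (n : B) (hn : IsNormalizer A n) (hnn : star n * n ∈ A)
    (Mn : Set B)
    (hMn : Mn = closure (Submodule.span ℂ
      {x : B | ∃ a ∈ A, ∃ a' ∈ A, x = a * n * a'} : Set B))
    (Fix : Set (WeakDual.characterSpace ℂ A))
    (hFix : Fix = {φ : WeakDual.characterSpace ℂ A |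
      0 < φ ⟨star n * n, hnn⟩ ∧
      ∀ a : A, φ ⟨star n * (a : B) * n, hn.1 (a : B) a.2⟩ = φ a * φ ⟨star n * n, hnn⟩})
    (V : Set (WeakDual.characterSpace ℂ A)) (hV : V = interior Fix)
    -- `W := X \ closure V` and `C₀(W) = {g ∈ A : φ(g) = 0 for all φ ∉ W}`
    (W : Set (WeakDual.characterSpace ℂ A)) (hW : W = (closure V)ᶜ)
    (C0W : Set B)
    (hC0W : C0W = {x : B | ∃ h : x ∈ A,
      ∀ φ : WeakDual.characterSpace ℂ A, φ ∉ W → φ ⟨x, h⟩ = 0}) :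
    closure (Submodule.span ℂ {x : B | ∃ m ∈ Mn, ∃ g ∈ C0W, x = m * g} : Set B)
      ∩ (A : Set B) = {0} := by
  subst hMn hFix hV hW hC0W
  have _ : IsClosed (A : Set B) := hAclosed
  let _ : NonUnitalCommCStarAlgebra A :=
    { NonUnitalStarSubalgebra.nonUnitalCStarAlgebra A with
      mul_comm := fun a b ↦ Subtype.ext (hAcomm a a.2 b b.2) }
  have hstar (φ : WeakDual.characterSpace ℂ A) (a : A) : φ (star a) = star (φ a) :=
    characterSpace_map_star φ a
  refine Set.eq_singleton_iff_unique_mem.2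
    ⟨⟨subset_closure (Submodule.zero_mem _), A.zero_mem⟩, ?_⟩
  rintro d ⟨hd, hdA⟩
  have hslice : d ∈ closure (Submodule.span ℂ (sliceGenerators A n) : Set B) := by
    rw [← Submodule.topologicalClosure_coe] at hd ⊢
    refine Submodule.topologicalClosure_minimal _ (Submodule.span_le.2 ?_)
      (Submodule.isClosed_topologicalClosure _) hd
    rintro _ ⟨m, hm, g, ⟨hg, -⟩, rfl⟩
    refine closure_span_induction
      (p := fun x ↦ x * g ∈ (Submodule.span ℂ (sliceGenerators A n)).topologicalClosure)
      ((Submodule.isClosed_topologicalClosure _).preimage (by fun_prop)) ?_ (by simp)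
      (fun x y h h' ↦ by simpa only [add_mul] using add_mem h h')
      (fun c x h ↦ by simpa only [smul_mul_assoc] using Submodule.smul_mem _ c h) hm
    rintro _ ⟨a, ha, a', ha', rfl⟩
    exact Submodule.le_topologicalClosure _ (Submodule.subset_span
      ⟨a, ha, a' * g, A.mul_mem ha' hg, by simp only [mul_assoc]⟩)
  let D : A := ⟨d, hdA⟩
  let N : A := ⟨star n * n, hnn⟩
  let E : A → A := fun b ↦ ⟨star n * (b : B) * n, hn.1 b b.2⟩
  have hDD (φ : WeakDual.characterSpace ℂ A) (h : φ D ≠ 0) : φ (star D * D) ≠ 0 := by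
    rw [map_mul, hstar]
    exact mul_ne_zero (star_ne_zero.2 h) h
  have hfix (φ : WeakDual.characterSpace ℂ A) (h : φ D ≠ 0) (b : A) :
      φ (E b) = φ b * φ N := by
    have e : star D * b * D * N = star D * D * E b :=
      Subtype.ext (hn.slice_intertwine hAcomm hnn b.2 hslice hslice)
    have e' : b * (star D * D) * N = star D * b * D * N := by
      rw [mul_comm (star D) b]
      simp only [mul_assoc]
    have e2 := congrArg φ (e'.trans e)
    rw [map_mul, map_mul, map_mul φ (star D * D) (E b)] at e2
    refine mul_left_cancel₀ (hDD φ h) (e2.symm.trans ?_)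
    ring
  have hpos (φ : WeakDual.characterSpace ℂ A) (h : φ D ≠ 0) : 0 < φ N := by
    obtain ⟨c, hc, hcs, hcc⟩ := exists_selfAdjoint_mul_self hAcomm hAmasa hnn
    have hN : N = star (⟨c, hc⟩ : A) * ⟨c, hc⟩ :=
      Subtype.ext (by change star n * n = star c * c; rw [hcs, hcc])
    refine lt_of_le_of_ne ?_ fun h0 ↦ hDD φ h ?_
    · rw [hN, map_mul, hstar]
      exact star_mul_self_nonneg _
    · refine hn.character_slice_eq_zero φ (fun b ↦ ?_) hslice
      exact (hfix φ h b).trans (by rw [← h0, mul_zero])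
  have hopen : IsOpen {φ : WeakDual.characterSpace ℂ A | φ D ≠ 0} :=
    isOpen_ne_fun ((WeakDual.eval_continuous D).comp continuous_subtype_val) continuous_const
  have hann : d * star d = 0 := by
    refine closure_span_induction (p := fun x ↦ x * star d = 0)
      (isClosed_eq (by fun_prop) (by fun_prop)) ?_ (by simp)
      (fun x y h h' ↦ by rw [add_mul, h, h', add_zero])
      (fun c x h ↦ by rw [smul_mul_assoc, h, smul_zero]) hd
    rintro _ ⟨m, -, g, ⟨hg, hg0⟩, rfl⟩
    have h0 : (⟨g, hg⟩ : A) * star D = 0 := by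
      refine eq_zero_of_forall_characterSpace _ fun φ ↦ ?_
      rw [map_mul, hstar]
      by_cases h : φ D = 0
      · rw [h, star_zero, mul_zero]
      · have hV := interior_maximal (t := {φ : WeakDual.characterSpace ℂ A | φ D ≠ 0})
          (s := {φ : WeakDual.characterSpace ℂ A | 0 < φ N ∧ ∀ a, φ (E a) = φ a * φ N})
          (fun ψ hψ ↦ ⟨hpos ψ hψ, hfix ψ hψ⟩) hopen h
        rw [hg0 φ (fun hW ↦ hW (subset_closure hV)), zero_mul]
    have h0' : g * star d = 0 := congrArg Subtype.val h0
    rw [mul_assoc, h0', mul_zero]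
  exact CStarRing.mul_star_self_eq_zero_iff d |>.1 hann
end

section
/- Let B be a C*-algebra and let A be a commutative closed *-subalgebra of B containing an approximate unit for B, and let n ∈ N(A,B) be a normaliser (so that n*n and n n* belong to A). Let X be the character space of A, and set dom(n) := {φ ∈ X : φ(n*n) > 0} and ran(n) := {φ ∈ X : φ(n n*) > 0}; these are open subsets of X. Then there exists a unique homeomorphism α_n : dom(n) → ran(n) such that φ(n* a n) = (α_n(φ))(a) · φ(n*n) for every φ ∈ dom(n) and every a ∈ A. -/
open scoped ComplexOrder

open WeakDual

/-- A multiplicative linear functional on a C*-algebra takes real values on self-adjoint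
elements. -/
theorem NonUnitalAlgHom.im_apply_eq_zero_of_isSelfAdjoint {A : Type*} [NonUnitalCStarAlgebra A]
    (φ : A →ₙₐ[ℂ] ℂ) {a : A} (ha : IsSelfAdjoint a) : (φ a).im = 0 := by
  have hmem : φ a ∈ quasispectrum ℂ a := by
    refine NonUnitalAlgHom.quasispectrum_apply_subset φ a ?_
    rw [quasispectrum_eq_spectrum_union_zero]
    exact Or.inl (by simp [spectrum.mem_iff])
  rw [Unitization.quasispectrum_eq_spectrum_inr' ℂ ℂ] at hmem
  exact (ha.inr ℂ).im_eq_zero_of_mem_spectrum hmem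

section

variable {B : Type*} [NonUnitalCStarAlgebra B] {A : NonUnitalStarSubalgebra ℂ B}

/-- The set of characters that are positive at a given self-adjoint element is open. -/
theorem isOpen_setOf_character_apply_pos (hA : IsClosed (A : Set B)) {a : A}
    (ha : IsSelfAdjoint a) : IsOpen {φ : characterSpace ℂ A | 0 < φ a} := by
  have him (φ : characterSpace ℂ A) : (φ a).im = 0 := by
    let _ : NonUnitalCStarAlgebra A :=
      NonUnitalStarSubalgebra.nonUnitalCStarAlgebra A (h_closed := hA)
    exact (CharacterSpace.toNonUnitalAlgHom φ).im_apply_eq_zero_of_isSelfAdjoint ha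
  have hcont : Continuous fun φ : characterSpace ℂ A ↦ φ a :=
    (eval_continuous a).comp continuous_subtype_val
  have heq : {φ : characterSpace ℂ A | 0 < φ a} = {φ | 0 < (φ a).re} := by
    ext φ
    simp [Complex.pos_iff, him φ]
  rw [heq]
  exact isOpen_lt continuous_const (Complex.continuous_re.comp hcont)

namespace NonUnitalStarSubalgebra

variable {n m : B}

/-- The continuous linear map `a ↦ m a n` on a subalgebra which it preserves. -/
def sandwich (h : ∀ a ∈ A, m * a * n ∈ A) : A →L[ℂ] A where
  toFun a := ⟨m * a * n, h a a.2⟩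
  map_add' a b := by ext; simp [mul_add, add_mul]
  map_smul' c a := by ext; simp [mul_smul_comm, smul_mul_assoc]
  cont := by fun_prop

theorem sandwich_mul (h : ∀ a ∈ A, m * a * n ∈ A)
    (hA : ∀ a ∈ A, ∀ a' ∈ A, a * a' = a' * a)
    (hmn : m * n ∈ A) (hnm : n * m ∈ A) (a b : A) :
    sandwich h (a * b) * ⟨m * n, hmn⟩ = sandwich h a * sandwich h b := by
  ext
  calc m * (a * b : B) * n * (m * n)
      = m * a * (b * (n * m)) * n := by simp only [mul_assoc]
    _ = m * a * n * (m * b * n) := by rw [hA b b.2 _ hnm]; simp only [mul_assoc]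

theorem sandwich_mk_mul (h : ∀ a ∈ A, m * a * n ∈ A) (hmn : m * n ∈ A) (hnm : n * m ∈ A) :
    sandwich h ⟨n * m, hnm⟩ = ⟨m * n, hmn⟩ * ⟨m * n, hmn⟩ := by
  ext
  simp [sandwich, mul_assoc]

theorem sandwich_sandwich (h : ∀ a ∈ A, m * a * n ∈ A) (h' : ∀ a ∈ A, n * a * m ∈ A)
    (hmn : m * n ∈ A) (a : A) :
    sandwich h (sandwich h' a) = ⟨m * n, hmn⟩ * a * ⟨m * n, hmn⟩ := by
  ext
  simp [sandwich, mul_assoc]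

/-- The character `a ↦ φ(m a n) / φ(m n)`. -/
noncomputable def transport (h : ∀ a ∈ A, m * a * n ∈ A)
    (hA : ∀ a ∈ A, ∀ a' ∈ A, a * a' = a' * a) (hmn : m * n ∈ A) (hnm : n * m ∈ A)
    (φ : characterSpace ℂ A) (hφ : φ ⟨m * n, hmn⟩ ≠ 0) : characterSpace ℂ A :=
  ⟨(φ ⟨m * n, hmn⟩)⁻¹ • (CharacterSpace.toCLM φ).comp (sandwich h), by
    constructor
    · intro h0
      have h1 : (φ ⟨m * n, hmn⟩)⁻¹ * φ (sandwich h ⟨n * m, hnm⟩) = 0 :=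
        DFunLike.congr_fun h0 _
      rw [sandwich_mk_mul h hmn, map_mul, inv_mul_cancel_left₀ hφ] at h1
      exact hφ h1
    · intro a b
      change (φ ⟨m * n, hmn⟩)⁻¹ * φ (sandwich h (a * b)) =
        (φ ⟨m * n, hmn⟩)⁻¹ * φ (sandwich h a) * ((φ ⟨m * n, hmn⟩)⁻¹ * φ (sandwich h b))
      have hab := congrArg φ (sandwich_mul h hA hmn hnm a b)
      rw [map_mul φ, map_mul φ] at hab
      field_simp
      rwa [mul_comm]⟩

theorem transport_apply (h : ∀ a ∈ A, m * a * n ∈ A)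
    (hA : ∀ a ∈ A, ∀ a' ∈ A, a * a' = a' * a) (hmn : m * n ∈ A) (hnm : n * m ∈ A)
    (φ : characterSpace ℂ A) (hφ : φ ⟨m * n, hmn⟩ ≠ 0) (a : A) :
    transport h hA hmn hnm φ hφ a = (φ ⟨m * n, hmn⟩)⁻¹ * φ (sandwich h a) := rfl

theorem transport_apply_mk_mul (h : ∀ a ∈ A, m * a * n ∈ A)
    (hA : ∀ a ∈ A, ∀ a' ∈ A, a * a' = a' * a) (hmn : m * n ∈ A) (hnm : n * m ∈ A)
    (φ : characterSpace ℂ A) (hφ : φ ⟨m * n, hmn⟩ ≠ 0) :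
    transport h hA hmn hnm φ hφ ⟨n * m, hnm⟩ = φ ⟨m * n, hmn⟩ := by
  rw [transport_apply, sandwich_mk_mul h hmn, map_mul, inv_mul_cancel_left₀ hφ]

/-- The map `φ ↦ φ(m · n) / φ(m n)` from the characters positive at `m n` to those positive
at `n m`. -/
noncomputable def transportMap (h : ∀ a ∈ A, m * a * n ∈ A)
    (hA : ∀ a ∈ A, ∀ a' ∈ A, a * a' = a' * a) (hmn : m * n ∈ A) (hnm : n * m ∈ A)
    (φ : {φ : characterSpace ℂ A | 0 < φ ⟨m * n, hmn⟩}) :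
    {φ : characterSpace ℂ A | 0 < φ ⟨n * m, hnm⟩} :=
  ⟨transport h hA hmn hnm φ φ.2.ne', by
    rw [Set.mem_ofPred_eq, transport_apply_mk_mul]
    exact φ.2⟩

theorem continuous_transportMap (h : ∀ a ∈ A, m * a * n ∈ A)
    (hA : ∀ a ∈ A, ∀ a' ∈ A, a * a' = a' * a) (hmn : m * n ∈ A) (hnm : n * m ∈ A) :
    Continuous (transportMap h hA hmn hnm) := by
  have hev (a : A) : Continuous fun φ : {φ : characterSpace ℂ A | 0 < φ ⟨m * n, hmn⟩} ↦
      (φ : characterSpace ℂ A) a :=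
    (eval_continuous a).comp (continuous_subtype_val.comp continuous_subtype_val)
  refine Continuous.subtype_mk (Continuous.subtype_mk ?_ _) _
  refine continuous_of_continuous_eval fun a ↦ ?_
  exact ((hev _).inv₀ fun φ ↦ φ.2.ne').mul (hev (sandwich h a))

theorem transportMap_transportMap (h : ∀ a ∈ A, m * a * n ∈ A) (h' : ∀ a ∈ A, n * a * m ∈ A)
    (hA : ∀ a ∈ A, ∀ a' ∈ A, a * a' = a' * a) (hmn : m * n ∈ A) (hnm : n * m ∈ A)
    (φ : {φ : characterSpace ℂ A | 0 < φ ⟨m * n, hmn⟩}) :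
    transportMap h' hA hnm hmn (transportMap h hA hmn hnm φ) = φ := by
  have hφ : (φ : characterSpace ℂ A) ⟨m * n, hmn⟩ ≠ 0 := φ.2.ne'
  refine Subtype.ext (CharacterSpace.ext fun a ↦ ?_)
  simp only [transportMap, transport_apply h' hA, transport_apply_mk_mul]
  rw [transport_apply, sandwich_sandwich h h' hmn, map_mul, map_mul]
  field_simp

/-- The homeomorphism `φ ↦ φ(m · n) / φ(m n)` from the characters positive at `m n` to those
positive at `n m`, with inverse `φ ↦ φ(n · m) / φ(n m)`. -/
noncomputable def transportHomeomorph (h : ∀ a ∈ A, m * a * n ∈ A)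
    (h' : ∀ a ∈ A, n * a * m ∈ A) (hA : ∀ a ∈ A, ∀ a' ∈ A, a * a' = a' * a)
    (hmn : m * n ∈ A) (hnm : n * m ∈ A) :
    {φ : characterSpace ℂ A | 0 < φ ⟨m * n, hmn⟩} ≃ₜ
      {φ : characterSpace ℂ A | 0 < φ ⟨n * m, hnm⟩} where
  toFun := transportMap h hA hmn hnm
  invFun := transportMap h' hA hnm hmn
  left_inv := transportMap_transportMap h h' hA hmn hnm
  right_inv := transportMap_transportMap h' h hA hnm hmn
  continuous_toFun := continuous_transportMap h hA hmn hnm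
  continuous_invFun := continuous_transportMap h' hA hnm hmn

theorem transportHomeomorph_apply_mul (h : ∀ a ∈ A, m * a * n ∈ A)
    (h' : ∀ a ∈ A, n * a * m ∈ A) (hA : ∀ a ∈ A, ∀ a' ∈ A, a * a' = a' * a)
    (hmn : m * n ∈ A) (hnm : n * m ∈ A)
    (φ : {φ : characterSpace ℂ A | 0 < φ ⟨m * n, hmn⟩}) (a : A) :
    (transportHomeomorph h h' hA hmn hnm φ : characterSpace ℂ A) a *
      (φ : characterSpace ℂ A) ⟨m * n, hmn⟩ =
        (φ : characterSpace ℂ A) ⟨m * a * n, h a a.2⟩ := by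
  change ((φ : characterSpace ℂ A) ⟨m * n, hmn⟩)⁻¹ * (φ : characterSpace ℂ A) (sandwich h a) *
    (φ : characterSpace ℂ A) ⟨m * n, hmn⟩ = (φ : characterSpace ℂ A) (sandwich h a)
  rw [mul_right_comm, inv_mul_cancel₀ φ.2.ne', one_mul]

end NonUnitalStarSubalgebra

end

/-- Let `A` be a commutative closed *-subalgebra of a C*-algebra `B`
containing an approximate unit for `B` (equivalently, the closed linear span of
`{a b : a ∈ A, b ∈ B}` is `B`), and let `n` be a normaliser with `n* n, n n* ∈ A`.
Then `dom(n) = {φ : φ(n* n) > 0}` and `ran(n) = {φ : φ(n n*) > 0}` are open subsets of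
the character space of `A`, and there is a unique homeomorphism
`α_n : dom(n) → ran(n)` with `φ(n* a n) = α_n(φ)(a) · φ(n* n)` for all `φ ∈ dom(n)`
and `a ∈ A`. -/
theorem stmt11 {B : Type*} [NonUnitalCStarAlgebra B]
    (A : NonUnitalStarSubalgebra ℂ B) (hAclosed : IsClosed (A : Set B))
    (hAcomm : ∀ a ∈ A, ∀ a' ∈ A, a * a' = a' * a)
    -- the inclusion is non-degenerate
    (hnondeg : closure (Submodule.span ℂ {x : B | ∃ a ∈ A, ∃ b : B, x = a * b} : Set B)
      = Set.univ)
    (n : B) (hn : IsNormalizer A n)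
    (hnn : star n * n ∈ A) (hnn' : n * star n ∈ A)
    (dom ran : Set (WeakDual.characterSpace ℂ A))
    (hdom : dom = {φ : WeakDual.characterSpace ℂ A | 0 < φ ⟨star n * n, hnn⟩})
    (hran : ran = {φ : WeakDual.characterSpace ℂ A | 0 < φ ⟨n * star n, hnn'⟩}) :
    IsOpen dom ∧ IsOpen ran ∧
      ∃! e : dom ≃ₜ ran, ∀ (φ : dom) (a : A),
        (φ : WeakDual.characterSpace ℂ A) ⟨star n * (a : B) * n, hn.1 (a : B) a.2⟩
          = (e φ : WeakDual.characterSpace ℂ A) a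
              * (φ : WeakDual.characterSpace ℂ A) ⟨star n * n, hnn⟩ := by
  subst hdom hran
  refine ⟨isOpen_setOf_character_apply_pos hAclosed (Subtype.ext (by simp)),
    isOpen_setOf_character_apply_pos hAclosed (Subtype.ext (by simp)),
    NonUnitalStarSubalgebra.transportHomeomorph hn.1 hn.2 hAcomm hnn hnn', fun φ a ↦ ?_,
    fun e he ↦ ?_⟩
  · exact (NonUnitalStarSubalgebra.transportHomeomorph_apply_mul hn.1 hn.2 hAcomm hnn hnn'
      φ a).symm
  · refine Homeomorph.ext fun φ ↦ Subtype.ext (CharacterSpace.ext fun a ↦ ?_)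
    refine mul_right_cancel₀ φ.2.ne' ?_
    rw [← he, NonUnitalStarSubalgebra.transportHomeomorph_apply_mul]
end
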